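/- Let G be a minimal counterexample, let v be a vertex of degree 7 having exactly four neighbors of degree 5, and let u be a neighbor of v such that both of the neighbors of v that are consecutive to u in the cyclic order around v have degree 5. Then deg u ≥ 9. -/

import Mathlib

open SimpleGraph

variable {V : Type}

/-- The involution of the darts of a graph reversing each dart. -/
def dartRev (G : SimpleGraph V) : Equiv.Perm G.Dart :=
  Function.Involutive.toPerm SimpleGraph.Dart.symm SimpleGraph.Dart.symm_involutive

/-- The face permutation of a rotation system `σ`: it sends a dart `(u,v)` to `σ (v,u)`. -/
def facePerm {G : SimpleGraph V} (σ : Equiv.Perm G.Dart) : Equiv.Perm G.Dart :=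
  (dartRev G).trans σ

/-- The setoid on `α` whose classes are the orbits (cycles) of a permutation of `α`. -/
def orbitSetoid {α : Type*} (f : Equiv.Perm α) : Setoid α :=
  ⟨f.SameCycle, ⟨fun x => Equiv.Perm.SameCycle.refl f x, fun h => h.symm, fun h h' => h.trans h'⟩⟩

/-- The number of faces of a rotation system: the number of orbits of the face permutation. -/
noncomputable def numFaces {G : SimpleGraph V} (σ : Equiv.Perm G.Dart) : ℕ :=
  Nat.card (Quotient (orbitSetoid (facePerm σ)))

/-- The number of darts in the face (orbit of the face permutation) containing the dart `d`. -/
noncomputable def faceSize {G : SimpleGraph V} (σ : Equiv.Perm G.Dart) (d : G.Dart) : ℕ :=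
  Nat.card {e : G.Dart // (facePerm σ).SameCycle d e}

/-- `σ` is a rotation system on `G`: every dart and its image share their first vertex, and
the `σ`-orbit of every dart consists of all darts sharing its first vertex. -/
structure IsRotationSystem (G : SimpleGraph V) (σ : Equiv.Perm G.Dart) : Prop where
  fst_eq : ∀ d : G.Dart, (σ d).toProd.1 = d.toProd.1
  orbit_eq : ∀ d e : G.Dart, d.toProd.1 = e.toProd.1 → σ.SameCycle d e

/-- The degree of a vertex. -/
noncomputable def deg (G : SimpleGraph V) (v : V) : ℕ := Nat.card (G.neighborSet v)

/-- A plane triangulation: a finite connected simple graph on at least 4 vertices equipped with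
a rotation system satisfying Euler's formula `|V| - |E| + F = 2` in which every face consists of
exactly 3 darts. -/
structure IsPlaneTriangulation [Fintype V] (G : SimpleGraph V) (σ : Equiv.Perm G.Dart) :
    Prop where
  connected : G.Connected
  four_le_card : 4 ≤ Fintype.card V
  rot : IsRotationSystem G σ
  euler : Fintype.card V + numFaces σ = Nat.card G.edgeSet + 2
  face_size_eq : ∀ d : G.Dart, faceSize σ d = 3

/-- A proper 5-coloring (colors `0,...,4` standing for `1,...,5`). -/
def Proper5 (G : SimpleGraph V) (c : V → Fin 5) : Prop :=
  ∀ ⦃u w : V⦄, G.Adj u w → c u ≠ c w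

/-- A finite simple graph is planar if it is isomorphic to a subgraph of a plane triangulation. -/
def IsPlanar [Fintype V] (G : SimpleGraph V) : Prop :=
  ∃ (W : Type) (iW : Fintype W) (T : SimpleGraph W) (σ : Equiv.Perm T.Dart),
    @IsPlaneTriangulation W iW T σ ∧ ∃ f : G →g T, Function.Injective f

/-- `w` is the neighbor of `v` following `u` in the cyclic (counterclockwise) order
around `v` given by the rotation system `σ`. -/
def NextNbr {G : SimpleGraph V} (σ : Equiv.Perm G.Dart) (v u w : V) : Prop :=
  ∃ h : G.Adj v u, (σ ⟨(v, u), h⟩).toProd.2 = w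

/-- A minimal counterexample: a plane triangulation admitting no proper 5-coloring with some
color class of size at most `|V|/6`, while every planar graph on fewer vertices admits one. -/
def IsMinimalCounterexample [Fintype V] (G : SimpleGraph V) (σ : Equiv.Perm G.Dart) : Prop :=
  IsPlaneTriangulation G σ ∧
  (¬ ∃ c : V → Fin 5, Proper5 G c ∧
      ∃ k : Fin 5, 6 * Nat.card {v : V | c v = k} ≤ Fintype.card V) ∧
  (∀ (W : Type) [Fintype W] (H : SimpleGraph W), IsPlanar H →
      Fintype.card W < Fintype.card V →
      ∃ c : W → Fin 5, Proper5 H c ∧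
        ∃ k : Fin 5, 6 * Nat.card {w : W | c w = k} ≤ Fintype.card W)


theorem card_sameCycle {α : Type*} [Finite α] (f : Equiv.Perm α) (d : α) :
    Nat.card {e // f.SameCycle d e} = Function.minimalPeriod f d := by
  have hpos : 0 < Function.minimalPeriod f d :=
    Function.minimalPeriod_pos_of_mem_periodicPts
      (Function.Injective.mem_periodicPts f.injective d)
  let g : Fin (Function.minimalPeriod f d) → {e // f.SameCycle d e} :=
    fun i => ⟨(f ^ (i : ℕ)) d, ⟨(i : ℕ), by simp⟩⟩
  have hg : Function.Bijective g := by
    constructor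
    · intro i j hij
      have h1 : (f ^ (i : ℕ)) d = (f ^ (j : ℕ)) d := congrArg Subtype.val hij
      rw [Equiv.Perm.coe_pow, Equiv.Perm.coe_pow] at h1
      exact Fin.ext (Function.iterate_injOn_Iio_minimalPeriod i.2 j.2 h1)
    · rintro ⟨e, he⟩
      obtain ⟨k, hk⟩ := he.exists_nat_pow_eq
      refine ⟨⟨k % Function.minimalPeriod f d, Nat.mod_lt _ hpos⟩, Subtype.ext ?_⟩
      change (f ^ (k % Function.minimalPeriod f d)) d = e
      rw [Equiv.Perm.coe_pow, Function.iterate_mod_minimalPeriod_eq, ← Equiv.Perm.coe_pow, hk]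
  rw [← Nat.card_congr (Equiv.ofBijective g hg), Nat.card_fin]

theorem finite_dart [Finite V] (G : SimpleGraph V) : Finite G.Dart :=
  Finite.of_injective (fun d : G.Dart => d.toProd) (fun a b h => SimpleGraph.Dart.ext _ _ h)

namespace RS
variable {G : SimpleGraph V} {σ : Equiv.Perm G.Dart}

theorem fst_pow (h : IsRotationSystem G σ) (k : ℕ) (d : G.Dart) :
    ((σ ^ k) d).toProd.1 = d.toProd.1 := by
  induction k with
  | zero => simp
  | succ k ih => rw [pow_succ', Equiv.Perm.mul_apply, h.fst_eq, ih]

theorem sameCycle_fst (h : IsRotationSystem G σ) {d e : G.Dart} [Finite V]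
    (hs : σ.SameCycle d e) : d.toProd.1 = e.toProd.1 := by
  haveI := finite_dart G
  obtain ⟨k, hk⟩ := hs.exists_nat_pow_eq
  rw [← hk, fst_pow h]

theorem deg_eq [Finite V] (h : IsRotationSystem G σ) (d : G.Dart) :
    Function.minimalPeriod σ d = deg G d.toProd.1 := by
  haveI := finite_dart G
  rw [← card_sameCycle, deg]
  refine Nat.card_congr ⟨fun e => ⟨e.1.toProd.2, ?_⟩, fun x => ⟨⟨(d.toProd.1, x.1), x.2⟩, ?_⟩, ?_, ?_⟩
  · have := sameCycle_fst h e.2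
    rw [SimpleGraph.mem_neighborSet, this]; exact e.1.adj
  · exact h.orbit_eq _ _ rfl
  · rintro ⟨e, he⟩
    have := sameCycle_fst h he
    apply Subtype.ext
    apply SimpleGraph.Dart.ext
    apply Prod.ext <;> simp [this]
  · rintro ⟨x, hx⟩; rfl

theorem exists_pow [Finite V] (h : IsRotationSystem G σ) (d e : G.Dart)
    (he : d.toProd.1 = e.toProd.1) : ∃ k < deg G d.toProd.1, (σ ^ k) d = e := by
  haveI := finite_dart G
  obtain ⟨k, hk⟩ := (h.orbit_eq d e he).exists_nat_pow_eq
  refine ⟨k % Function.minimalPeriod σ d, ?_, ?_⟩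
  · rw [← deg_eq h d]
    exact Nat.mod_lt _ (Function.minimalPeriod_pos_of_mem_periodicPts
      (Function.Injective.mem_periodicPts σ.injective d))
  · rw [Equiv.Perm.coe_pow, Function.iterate_mod_minimalPeriod_eq, ← Equiv.Perm.coe_pow, hk]

theorem pow_inj [Finite V] (h : IsRotationSystem G σ) (d : G.Dart) {i j : ℕ}
    (hi : i < deg G d.toProd.1) (hj : j < deg G d.toProd.1)
    (hij : (σ ^ i) d = (σ ^ j) d) : i = j := by
  rw [← deg_eq h d] at hi hj
  rw [Equiv.Perm.coe_pow, Equiv.Perm.coe_pow] at hij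
  exact Function.iterate_injOn_Iio_minimalPeriod hi hj hij

theorem pow_deg [Finite V] (h : IsRotationSystem G σ) (d : G.Dart) :
    (σ ^ deg G d.toProd.1) d = d := by
  rw [← deg_eq h d, Equiv.Perm.coe_pow, Function.iterate_minimalPeriod]

theorem face_cube [Finite V] (h : ∀ d : G.Dart, faceSize σ d = 3) (d : G.Dart) :
    facePerm σ (facePerm σ (facePerm σ d)) = d := by
  haveI := finite_dart G
  have h1 := h d
  rw [faceSize, card_sameCycle] at h1
  have := Function.iterate_minimalPeriod (f := facePerm σ) (x := d)
  rw [h1] at this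
  exact this

theorem facePerm_apply (d : G.Dart) : facePerm σ d = σ d.symm := rfl

theorem nextNbr_iff (h : IsRotationSystem G σ) {v u w : V} :
    NextNbr σ v u w ↔ ∃ (h1 : G.Adj v u) (h2 : G.Adj v w), σ ⟨(v, u), h1⟩ = ⟨(v, w), h2⟩ := by
  constructor
  · rintro ⟨h1, h2⟩
    have h3 := h.fst_eq ⟨(v, u), h1⟩
    have h4 : G.Adj v w := by
      have := (σ ⟨(v, u), h1⟩).adj
      rw [h2, h3] at this; exact this
    exact ⟨h1, h4, SimpleGraph.Dart.ext _ _ (Prod.ext h3 h2)⟩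
  · rintro ⟨h1, h2, h3⟩
    exact ⟨h1, by rw [h3]⟩

/-- The triangle rule. -/
theorem next_rot [Finite V] (h : IsRotationSystem G σ) (hf : ∀ d : G.Dart, faceSize σ d = 3)
    {v u w : V} (hn : NextNbr σ v u w) : NextNbr σ w v u := by
  obtain ⟨h1, h2, h3⟩ := (nextNbr_iff h).1 hn
  -- facePerm (u,v) = (v,w)
  have e1 : facePerm σ ⟨(u, v), h1.symm⟩ = ⟨(v, w), h2⟩ := h3
  have e2 := face_cube hf ⟨(u, v), h1.symm⟩
  rw [e1] at e2
  -- facePerm (v,w) = d with facePerm d = (u,v)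
  refine ⟨h2.symm, ?_⟩
  have e3 : facePerm σ ⟨(v, w), h2⟩ = σ ⟨(w, v), h2.symm⟩ := rfl
  rw [e3] at e2
  have e4 : (σ (σ ⟨(w, v), h2.symm⟩).symm).toProd.1 = u := by
    have := congrArg (fun d : G.Dart => d.toProd.1) e2
    exact this
  rw [h.fst_eq] at e4
  exact e4

theorem next_adj [Finite V] (h : IsRotationSystem G σ) (hf : ∀ d : G.Dart, faceSize σ d = 3)
    {v u w : V} (hn : NextNbr σ v u w) : G.Adj u w := by
  obtain ⟨_, h2, _⟩ := (nextNbr_iff h).1 (next_rot h hf hn)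
  exact h2.symm

end RS

namespace RS
variable {G : SimpleGraph V} {σ : Equiv.Perm G.Dart}

open Classical in
/-- boundary mod 2 of a 1-chain -/
noncomputable def bd [Fintype V] [Fintype G.Dart] : (G.edgeSet → ZMod 2) →ₗ[ZMod 2] (V → ZMod 2) where
  toFun κ := fun v => ∑ d : G.Dart, if d.toProd.1 = v then κ ⟨d.edge, d.edge_mem⟩ else 0
  map_add' a b := by
    funext v
    simp only [Pi.add_apply, ← Finset.sum_add_distrib]
    refine Finset.sum_congr rfl fun d _ => ?_
    split_ifs <;> simp
  map_smul' r a := by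
    funext v
    simp only [Pi.smul_apply, Finset.smul_sum, RingHom.id_apply]
    refine Finset.sum_congr rfl fun d _ => ?_
    split_ifs <;> simp

/-- a dart over an edge -/
noncomputable def rep (e : G.edgeSet) : G.Dart :=
  Classical.choose (show ∃ d : G.Dart, d.edge = e.1 from by
    obtain ⟨e, he⟩ := e
    induction e using Sym2.ind with
    | _ x y => exact ⟨⟨(x, y), he⟩, rfl⟩)

theorem rep_edge (e : G.edgeSet) : (rep e).edge = e.1 :=
  Classical.choose_spec (show ∃ d : G.Dart, d.edge = e.1 from by
    obtain ⟨e, he⟩ := e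
    induction e using Sym2.ind with
    | _ x y => exact ⟨⟨(x, y), he⟩, rfl⟩)

/-- boundary mod 2 of a 2-chain -/
noncomputable def bd2 (σ : Equiv.Perm G.Dart) :
    (Quotient (orbitSetoid (facePerm σ)) → ZMod 2) →ₗ[ZMod 2] (G.edgeSet → ZMod 2) where
  toFun X := fun e => X (Quotient.mk _ (rep e)) + X (Quotient.mk _ (rep e).symm)
  map_add' a b := by
    funext v
    simp only [Pi.add_apply]; ring
  map_smul' r a := by
    funext v
    simp only [Pi.smul_apply, RingHom.id_apply, smul_eq_mul]; ring

theorem bd2_apply (X : Quotient (orbitSetoid (facePerm σ)) → ZMod 2) (d : G.Dart) :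
    bd2 σ X ⟨d.edge, d.edge_mem⟩ = X (Quotient.mk _ d) + X (Quotient.mk _ d.symm) := by
  have h := rep_edge (G := G) ⟨d.edge, d.edge_mem⟩
  change X (Quotient.mk _ (rep _)) + X (Quotient.mk _ (rep _).symm) = _
  rcases (SimpleGraph.dart_edge_eq_iff _ _).1 h with h | h
  · rw [h]
  · rw [h, SimpleGraph.Dart.symm_symm, add_comm]

theorem mk_symm (d : G.Dart) :
    (Quotient.mk (orbitSetoid (facePerm σ)) d.symm) = Quotient.mk _ (σ d) := by
  apply Quotient.sound
  refine ⟨1, ?_⟩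
  simp [facePerm_apply]

theorem bd_bd2 [Fintype V] [Fintype G.Dart] (h : IsRotationSystem G σ)
    (X : Quotient (orbitSetoid (facePerm σ)) → ZMod 2) : bd (bd2 σ X) = 0 := by
  classical
  funext v
  change (∑ d : G.Dart, if d.toProd.1 = v then bd2 σ X ⟨d.edge, d.edge_mem⟩ else 0) = 0
  simp only [bd2_apply, mk_symm]
  have h1 : (∑ d : G.Dart, if d.toProd.1 = v then X (Quotient.mk _ (σ d)) else 0)
      = ∑ d : G.Dart, if d.toProd.1 = v then X (Quotient.mk _ d) else 0 := by
    rw [← Equiv.sum_comp σ (fun d => if d.toProd.1 = v then X (Quotient.mk _ d) else 0)]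
    simp only [h.fst_eq]
  have h2 : ∀ d : G.Dart, (if d.toProd.1 = v then X (Quotient.mk _ d) + X (Quotient.mk _ (σ d)) else 0)
      = (if d.toProd.1 = v then X (Quotient.mk _ d) else 0)
        + (if d.toProd.1 = v then X (Quotient.mk _ (σ d)) else 0) := by
    intro d; split_ifs <;> simp
  simp only [h2, Finset.sum_add_distrib, h1]
  exact CharTwo.add_self_eq_zero _

open Classical in
theorem bd_single [Fintype V] [Fintype G.Dart] (d : G.Dart) :
    bd (Pi.single (⟨d.edge, d.edge_mem⟩ : G.edgeSet) 1) =
      (Pi.single d.toProd.1 1 + Pi.single d.toProd.2 1 : V → ZMod 2) := by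
  funext v
  change (∑ d' : G.Dart, if d'.toProd.1 = v then
    (Pi.single (⟨d.edge, d.edge_mem⟩ : G.edgeSet) 1 : G.edgeSet → ZMod 2) ⟨d'.edge, d'.edge_mem⟩ else 0) = _
  have h1 : ∀ d' : G.Dart, (if d'.toProd.1 = v then
    (Pi.single (⟨d.edge, d.edge_mem⟩ : G.edgeSet) 1 : G.edgeSet → ZMod 2) ⟨d'.edge, d'.edge_mem⟩ else 0)
      = (if d' = d then (if d.toProd.1 = v then 1 else 0) else 0)
       + (if d' = d.symm then (if d.toProd.2 = v then 1 else 0) else 0) := by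
    intro d'
    simp only [Pi.single_apply, Subtype.mk.injEq, SimpleGraph.dart_edge_eq_iff]
    have hne : d.symm ≠ d := SimpleGraph.Dart.symm_ne d
    by_cases h1 : d' = d
    · subst h1; simp [hne.symm]
    · by_cases h2 : d' = d.symm
      · subst h2; simp [hne]
      · simp [h1, h2]
  rw [Finset.sum_congr rfl (fun d' _ => h1 d')]
  simp only [Finset.sum_add_distrib, Finset.sum_ite_eq', Finset.mem_univ, if_true,
    Pi.add_apply, Pi.single_apply, eq_comm (a := v)]

theorem walk_prop (hc : G.Connected) (P : V → Prop) (hP : ∀ x y, G.Adj x y → P x → P y)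
    (x y : V) (hx : P x) : P y := by
  obtain ⟨p⟩ := hc.preconnected x y
  induction p with
  | nil => exact hx
  | cons h p ih => exact ih (hP _ _ h hx)

theorem ker_bd2 [Fintype V] (hT : IsPlaneTriangulation G σ) (d0 : G.Dart) :
    LinearMap.ker (bd2 σ) ≤ Submodule.span (ZMod 2) {fun _ => 1} := by
  intro X hX
  have hX' : ∀ d : G.Dart, X (Quotient.mk _ d) = X (Quotient.mk _ d.symm) := by
    intro d
    have h1 : bd2 σ X ⟨d.edge, d.edge_mem⟩ = 0 := by
      rw [LinearMap.mem_ker.1 hX]; rfl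
    rw [bd2_apply] at h1
    exact CharTwo.add_eq_zero.1 h1
  have hs : ∀ d : G.Dart, X (Quotient.mk _ (σ d)) = X (Quotient.mk _ d) := by
    intro d; rw [hX' d, mk_symm]
  have hfin := finite_dart G
  have hvert : ∀ d e : G.Dart, d.toProd.1 = e.toProd.1 →
      X (Quotient.mk _ d) = X (Quotient.mk _ e) := by
    intro d e hde
    obtain ⟨k, hk⟩ := (hT.rot.orbit_eq d e hde).exists_nat_pow_eq
    have : ∀ k : ℕ, X (Quotient.mk _ ((σ ^ k) d)) = X (Quotient.mk _ d) := by
      intro k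
      induction k with
      | zero => simp
      | succ k ih => rw [pow_succ', Equiv.Perm.mul_apply, hs, ih]
    rw [← hk, this]
  have hall : ∀ y : V, ∀ d : G.Dart, d.toProd.1 = y →
      X (Quotient.mk _ d) = X (Quotient.mk _ d0) := by
    intro y
    refine walk_prop hT.connected (fun y => ∀ d : G.Dart, d.toProd.1 = y →
      X (Quotient.mk _ d) = X (Quotient.mk _ d0)) ?_ d0.toProd.1 y (fun d hd => hvert _ _ hd)
    intro x y hxy hx d hd
    rw [hvert d ⟨(y, x), hxy.symm⟩ hd, hX']
    exact hx ⟨(x, y), hxy⟩ rfl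
  rw [Submodule.mem_span_singleton]
  refine ⟨X (Quotient.mk _ d0), ?_⟩
  funext q
  induction q using Quotient.ind with
  | _ d => simp [hall _ d rfl]

open Classical in
theorem range_bd [Fintype V] [Fintype G.Dart] (hc : G.Connected) (x0 : V) :
    LinearMap.range (bd (G := G)) ⊔ Submodule.span (ZMod 2) {Pi.single x0 1} = ⊤ := by
  have key : ∀ y : V, (Pi.single y 1 : V → ZMod 2) ∈
      LinearMap.range (bd (G := G)) ⊔ Submodule.span (ZMod 2) {Pi.single x0 1} := by
    intro y
    refine walk_prop hc (fun y => (Pi.single y 1 : V → ZMod 2) ∈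
      LinearMap.range (bd (G := G)) ⊔ Submodule.span (ZMod 2) {Pi.single x0 1}) ?_ x0 y
      (Submodule.mem_sup_right (Submodule.mem_span_singleton_self _))
    intro x y hxy hx
    have h1 : (Pi.single x 1 + Pi.single y 1 : V → ZMod 2) ∈ LinearMap.range (bd (G := G)) := by
      exact ⟨_, bd_single (G := G) ⟨(x, y), hxy⟩⟩
    have h2 : (Pi.single y 1 : V → ZMod 2) =
        (Pi.single x 1 + Pi.single y 1 : V → ZMod 2) + Pi.single x 1 := by
      rw [add_right_comm, ← two_nsmul]
      have h3 : ∀ g : V → ZMod 2, 2 • g = 0 := by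
        intro g; funext z; rw [two_nsmul]; exact CharTwo.add_self_eq_zero _
      rw [h3, zero_add]
    rw [h2]
    exact Submodule.add_mem _ (Submodule.mem_sup_left h1) hx
  rw [eq_top_iff]
  intro f _
  have : f = ∑ y, f y • (Pi.single y 1 : V → ZMod 2) := by
    funext z
    simp [Finset.sum_apply, Pi.single_apply]
  rw [this]
  exact Submodule.sum_mem _ fun y _ => Submodule.smul_mem _ _ (key y)

theorem exact [Fintype V] [Fintype G.Dart] (hT : IsPlaneTriangulation G σ) (d0 : G.Dart) :
    LinearMap.range (bd2 σ) = LinearMap.ker (bd (G := G)) := by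
  classical
  have : Finite (Quotient (orbitSetoid (facePerm σ))) := inferInstance
  letI : Fintype (Quotient (orbitSetoid (facePerm σ))) := Fintype.ofFinite _
  letI : Fintype G.edgeSet := Fintype.ofFinite _
  apply Submodule.eq_of_le_of_finrank_le
  · rintro _ ⟨X, rfl⟩
    exact bd_bd2 hT.rot X
  · have r1 := LinearMap.finrank_range_add_finrank_ker (bd2 σ)
    have r2 := LinearMap.finrank_range_add_finrank_ker (bd (G := G))
    rw [Module.finrank_pi] at r1 r2
    have k1 := Submodule.finrank_mono (ker_bd2 hT d0)
    have k2 := finrank_span_le_card (R := ZMod 2)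
      ({fun _ => 1} : Set (Quotient (orbitSetoid (facePerm σ)) → ZMod 2))
    have k3 := finrank_span_le_card (R := ZMod 2)
      ({Pi.single d0.toProd.1 1} : Set (V → ZMod 2))
    simp only [Set.toFinset_singleton, Finset.card_singleton] at k2 k3
    have k4 := Submodule.finrank_add_le_finrank_add_finrank (LinearMap.range (bd (G := G)))
      (Submodule.span (ZMod 2) {Pi.single d0.toProd.1 1})
    rw [range_bd hT.connected, finrank_top, Module.finrank_pi] at k4
    have e := hT.euler
    rw [numFaces, Nat.card_eq_fintype_card, Nat.card_eq_fintype_card] at e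
    omega
end RS

namespace RS
variable {G : SimpleGraph V} {σ : Equiv.Perm G.Dart}

/-- connected inside a set -/
def ConnIn (G : SimpleGraph V) (A : V → Prop) : V → V → Prop :=
  Relation.ReflTransGen (fun x y => G.Adj x y ∧ A x ∧ A y)

open Classical in
theorem chain [Fintype V] [Fintype G.Dart] (A : V → Prop) {x y : V} (h : ConnIn G A x y) :
    ∃ κ : G.edgeSet → ZMod 2, bd κ = Pi.single x 1 + Pi.single y 1 ∧
      ∀ d : G.Dart, κ ⟨d.edge, d.edge_mem⟩ ≠ 0 → A d.toProd.1 := by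
  have two : ∀ g : V → ZMod 2, g + g = 0 := by
    intro g; funext z; exact CharTwo.add_self_eq_zero _
  induction h with
  | refl => exact ⟨0, by rw [map_zero, two], by simp⟩
  | tail _ hs ih =>
    rename_i y z _
    obtain ⟨κ, h1, h2⟩ := ih
    obtain ⟨ha, hy, hz⟩ := hs
    refine ⟨κ + Pi.single (⟨(⟨(y, z), ha⟩ : G.Dart).edge, SimpleGraph.Dart.edge_mem _⟩ : G.edgeSet) 1,
      ?_, ?_⟩
    · rw [map_add, h1, bd_single]
      have : ∀ a b c : V → ZMod 2, a + b + (b + c) = a + c := by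
        intro a b c
        rw [add_assoc, ← add_assoc b b c, two, zero_add]
      exact this _ _ _
    · intro d hd
      by_cases h3 : κ ⟨d.edge, d.edge_mem⟩ = 0
      · rw [Pi.add_apply, h3, zero_add, Pi.single_apply] at hd
        split_ifs at hd with h4
        · rw [Subtype.mk.injEq, SimpleGraph.dart_edge_eq_iff] at h4
          rcases h4 with h4 | h4
          · rw [h4]; exact hy
          · rw [h4]; exact hz
        · exact absurd rfl hd
      · exact h2 d h3

theorem cross [Fintype V] (hT : IsPlaneTriangulation G σ) (d0 : G.Dart) (i j k : ℕ)
    (hi : 0 < i) (hij : i < j) (hjk : j < k) (hk : k < deg G d0.toProd.1)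
    (A B : V → Prop) (hAB : ∀ x, A x → B x → False)
    (hAz : ¬ A d0.toProd.1) (hBz : ¬ B d0.toProd.1)
    (a1 : A d0.toProd.2) (a3 : A ((σ ^ j) d0).toProd.2)
    (b2 : B ((σ ^ i) d0).toProd.2) (b4 : B ((σ ^ k) d0).toProd.2)
    (hA : ConnIn G A d0.toProd.2 ((σ ^ j) d0).toProd.2)
    (hB : ConnIn G B ((σ ^ i) d0).toProd.2 ((σ ^ k) d0).toProd.2) : False := by
  classical
  have hfin := finite_dart G
  letI : Fintype G.Dart := Fintype.ofFinite _
  have hr := hT.rot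
  obtain ⟨κ, h1, h2⟩ := chain A hA
  have two : ∀ g : V → ZMod 2, g + g = 0 := by
    intro g; funext z; exact CharTwo.add_self_eq_zero _
  obtain ⟨dj, hdj⟩ : ∃ dj, dj = (σ ^ j) d0 := ⟨_, rfl⟩
  obtain ⟨κ', hκ'⟩ : ∃ κ', κ' = κ + Pi.single (⟨d0.edge, d0.edge_mem⟩ : G.edgeSet) 1
    + Pi.single (⟨dj.edge, dj.edge_mem⟩ : G.edgeSet) 1 := ⟨_, rfl⟩
  have hdj1 : dj.toProd.1 = d0.toProd.1 := by rw [hdj, fst_pow hr]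
  have hb : bd κ' = 0 := by
    rw [hκ', map_add, map_add, h1, bd_single, bd_single, ← hdj, hdj1]
    have : ∀ a b c : V → ZMod 2, a + b + (c + a) + (c + b) = 0 := by
      intro a b c
      have : a + b + (c + a) + (c + b) = (a + a) + (b + b) + (c + c) := by ring
      rw [this, two, two, zero_add, zero_add, two]
    exact this _ _ _
  have hmem : κ' ∈ LinearMap.range (bd2 σ) := by
    rw [exact hT d0]; exact hb
  obtain ⟨X, hX⟩ := hmem
  obtain ⟨Y, hY⟩ : ∃ Y : G.Dart → ZMod 2, ∀ d, Y d = X (Quotient.mk _ d) := ⟨_, fun _ => rfl⟩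
  have e1 : ∀ d : G.Dart, Y d + Y d.symm = κ' ⟨d.edge, d.edge_mem⟩ := by
    intro d; rw [← hX, bd2_apply, hY, hY]
  have e2 : ∀ d : G.Dart, Y d.symm = Y (σ d) := by
    intro d; rw [hY, hY, mk_symm]
  have val : ∀ d : G.Dart, ¬ A d.toProd.1 → κ' ⟨d.edge, d.edge_mem⟩ =
      (if d = d0 ∨ d = d0.symm then 1 else 0) + (if d = dj ∨ d = dj.symm then 1 else 0) := by
    intro d hd
    have : κ ⟨d.edge, d.edge_mem⟩ = 0 := by
      by_contra h; exact hd (h2 d h)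
    rw [hκ', Pi.add_apply, Pi.add_apply, this, zero_add]
    simp only [Pi.single_apply, Subtype.mk.injEq, SimpleGraph.dart_edge_eq_iff]
  -- values at z
  have fz : ∀ m, ((σ ^ m) d0).toProd.1 = d0.toProd.1 := fun m => fst_pow hr m d0
  have ns0 : ∀ m, (σ ^ m) d0 ≠ d0.symm := by
    intro m h
    have := fz m
    rw [h] at this
    exact d0.adj.ne this.symm
  have nsj : ∀ m, (σ ^ m) d0 ≠ dj.symm := by
    intro m h
    have := fz m
    rw [h, ← hdj1] at this
    exact dj.adj.ne this.symm
  have stepz : ∀ m, 0 < m → m < deg G d0.toProd.1 →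
      Y ((σ ^ (m + 1)) d0) = Y ((σ ^ m) d0) + (if m = j then 1 else 0) := by
    intro m hm hmd
    have h3 := e1 ((σ ^ m) d0)
    rw [val _ (by rw [fz]; exact hAz), e2] at h3
    have h4 : (σ ^ m) d0 ≠ d0 := by
      intro h
      have := pow_inj hr d0 hmd (by omega : 0 < deg G d0.toProd.1) (by simpa using h)
      omega
    have h5 : (σ ^ m) d0 = dj ↔ m = j := by
      constructor
      · intro h; rw [hdj] at h; exact pow_inj hr d0 hmd (by omega) h
      · rintro rfl; exact hdj.symm
    simp only [h4, ns0, nsj, h5, or_false, if_false, zero_add] at h3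
    rw [pow_succ', Equiv.Perm.mul_apply, ← h3, ← add_assoc, CharTwo.add_self_eq_zero, zero_add]
  have lo : ∀ m, 0 < m → m ≤ j → Y ((σ ^ m) d0) = Y ((σ ^ 1) d0) := by
    intro m hm
    induction m, hm using Nat.le_induction with
    | base => intro _; rfl
    | succ m hm ih =>
      intro hmj
      rw [stepz m hm (by omega), ih (by omega), if_neg (by omega), add_zero]
  have hi' : ∀ m, j + 1 ≤ m → m < deg G d0.toProd.1 → Y ((σ ^ m) d0) = Y ((σ ^ 1) d0) + 1 := by
    intro m hm
    induction m, hm using Nat.le_induction with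
    | base => intro _; rw [stepz j (by omega) (by omega), lo j (by omega) le_rfl, if_pos rfl]
    | succ m hm ih =>
      intro hmj
      rw [stepz m (by omega) (by omega), ih (by omega), if_neg (by omega), add_zero]
  -- values on B
  have zeroB : ∀ d : G.Dart, B d.toProd.1 → κ' ⟨d.edge, d.edge_mem⟩ = 0 := by
    intro d hd
    rw [val d (fun h => hAB _ h hd), if_neg, if_neg, add_zero]
    · rintro (h | h)
      · rw [h, hdj1] at hd; exact hBz hd
      · rw [h] at hd; exact hAB _ (by rw [hdj]; exact a3) hd
    · rintro (h | h)
      · rw [h] at hd; exact hBz hd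
      · rw [h] at hd; exact hAB _ a1 hd
  have symB : ∀ d : G.Dart, B d.toProd.1 → Y d = Y d.symm := by
    intro d hd
    have := e1 d
    rw [zeroB d hd] at this
    exact CharTwo.add_eq_zero.1 this
  have vertB : ∀ d e : G.Dart, B d.toProd.1 → d.toProd.1 = e.toProd.1 → Y d = Y e := by
    intro d e hd hde
    obtain ⟨k, -, hk⟩ := exists_pow hr d e hde
    have : ∀ k : ℕ, Y ((σ ^ k) d) = Y d := by
      intro k
      induction k with
      | zero => simp
      | succ k ih =>
        rw [pow_succ', Equiv.Perm.mul_apply, ← e2, ← symB, ih]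
        rw [fst_pow hr]; exact hd
    rw [← hk, this]
  have all : ∀ y, ConnIn G B ((σ ^ i) d0).toProd.2 y → B y ∧ ∀ d : G.Dart, d.toProd.1 = y →
      Y d = Y ((σ ^ i) d0).symm := by
    intro y hy
    induction hy with
    | refl => exact ⟨b2, fun d hd => vertB _ _ (by rw [hd]; exact b2) hd⟩
    | tail _ hs ih =>
      rename_i y z _
      refine ⟨hs.2.2, fun d hd => ?_⟩
      rw [vertB d ⟨(z, y), hs.1.symm⟩ (by rw [hd]; exact hs.2.2) hd,
        symB _ (by exact hs.2.2)]
      exact ih.2 ⟨(y, z), hs.1⟩ rfl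
  have f1 := (all _ hB).2 ((σ ^ k) d0).symm rfl
  have g1 := symB ((σ ^ k) d0).symm b4
  have g2 := symB ((σ ^ i) d0).symm b2
  rw [SimpleGraph.Dart.symm_symm] at g1 g2
  rw [g1, g2, lo i hi (by omega), hi' k (by omega) hk] at f1
  simp at f1
end RS

namespace RS
variable {G : SimpleGraph V} {σ : Equiv.Perm G.Dart}

theorem ConnIn.symm {A : V → Prop} {x y : V} (h : ConnIn G A x y) : ConnIn G A y x := by
  induction h with
  | refl => exact Relation.ReflTransGen.refl
  | tail _ hs ih => exact Relation.ReflTransGen.head ⟨hs.1.symm, hs.2.2, hs.2.1⟩ ih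

/-- The pairs a,c and b,d separate each other around z. -/
def Cr (G : SimpleGraph V) (z a b c d : V) : Prop :=
  ∀ A B : V → Prop, (∀ x, A x → B x → False) → ¬ A z → ¬ B z → A a → A c → B b → B d →
    ConnIn G A a c → ConnIn G B b d → False

theorem Cr.rot {z a b c d : V} (h : Cr G z a b c d) : Cr G z b c d a :=
  fun A B h1 h2 h3 h4 h5 h6 h7 h8 h9 =>
    h B A (fun x hx hy => h1 x hy hx) h3 h2 h7 h6 h4 h5 h9.symm h8

theorem Cr.flip {z a b c d : V} (h : Cr G z a b c d) : Cr G z a d c b :=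
  fun A B h1 h2 h3 h4 h5 h6 h7 h8 h9 => h A B h1 h2 h3 h4 h5 h7 h6 h8 h9.symm

theorem cr_of_pos [Fintype V] (hT : IsPlaneTriangulation G σ) {z a b c d : V}
    (h : G.Adj z a) (i j k : ℕ)
    (hi : 0 < i) (hij : i < j) (hjk : j < k) (hk : k < deg G z)
    (hb : ((σ ^ i) ⟨(z, a), h⟩).toProd.2 = b) (hc : ((σ ^ j) ⟨(z, a), h⟩).toProd.2 = c)
    (hd : ((σ ^ k) ⟨(z, a), h⟩).toProd.2 = d) : Cr G z a b c d := by
  subst hb hc hd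
  intro A B h1 h2 h3 h4 h5 h6 h7 h8 h9
  exact cross hT ⟨(z, a), h⟩ i j k hi hij hjk hk A B h1 h2 h3 h4 h5 h6 h7 h8 h9

theorem exists_pos [Fintype V] (hr : IsRotationSystem G σ) {z a b : V} (h : G.Adj z a)
    (hb : G.Adj z b) (hab : a ≠ b) :
    ∃ i, 0 < i ∧ i < deg G z ∧ ((σ ^ i) ⟨(z, a), h⟩) = ⟨(z, b), hb⟩ := by
  obtain ⟨k, hk, hk'⟩ := exists_pow hr ⟨(z, a), h⟩ ⟨(z, b), hb⟩ rfl
  refine ⟨k, ?_, hk, hk'⟩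
  rcases Nat.eq_zero_or_pos k with rfl | h0
  · exfalso
    have := congrArg (fun d : G.Dart => d.toProd.2) hk'
    exact hab (by simpa using this)
  · exact h0

theorem four_nbrs [Fintype V] (hT : IsPlaneTriangulation G σ) {z p q r s : V}
    (hp : G.Adj z p) (hq : G.Adj z q) (hr : G.Adj z r) (hs : G.Adj z s)
    (hpq : p ≠ q) (hpr : p ≠ r) (hps : p ≠ s) (hqr : q ≠ r) (hqs : q ≠ s) (hrs : r ≠ s) :
    Cr G z p q r s ∨ Cr G z p r q s ∨ Cr G z p q s r := by
  obtain ⟨i, i0, i1, i2⟩ := exists_pos hT.rot hp hq hpq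
  obtain ⟨j, j0, j1, j2⟩ := exists_pos hT.rot hp hr hpr
  obtain ⟨k, k0, k1, k2⟩ := exists_pos hT.rot hp hs hps
  have hij : i ≠ j := by
    rintro rfl
    rw [i2] at j2
    exact hqr (congrArg (fun d : G.Dart => d.toProd.2) j2)
  have hik : i ≠ k := by
    rintro rfl
    rw [i2] at k2
    exact hqs (congrArg (fun d : G.Dart => d.toProd.2) k2)
  have hjk : j ≠ k := by
    rintro rfl
    rw [j2] at k2
    exact hrs (congrArg (fun d : G.Dart => d.toProd.2) k2)
  have e1 : ((σ ^ i) ⟨(z, p), hp⟩).toProd.2 = q := by rw [i2]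
  have e2 : ((σ ^ j) ⟨(z, p), hp⟩).toProd.2 = r := by rw [j2]
  have e3 : ((σ ^ k) ⟨(z, p), hp⟩).toProd.2 = s := by rw [k2]
  rcases lt_or_gt_of_ne hij with a | a <;> rcases lt_or_gt_of_ne hik with b | b <;>
    rcases lt_or_gt_of_ne hjk with c | c
  · exact Or.inl (cr_of_pos hT hp i j k i0 a c k1 e1 e2 e3)
  · exact Or.inr (Or.inr (cr_of_pos hT hp i k j i0 b c j1 e1 e3 e2))
  · omega
  · exact Or.inr (Or.inl (cr_of_pos hT hp k i j k0 b a j1 e3 e1 e2).flip)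
  · exact Or.inr (Or.inl (cr_of_pos hT hp j i k j0 a b k1 e2 e1 e3))
  · omega
  · exact Or.inr (Or.inr (cr_of_pos hT hp j k i j0 c b i1 e2 e3 e1).flip)
  · exact Or.inl (cr_of_pos hT hp k j i k0 c a i1 e3 e2 e1).flip

/-- State: the vertices outside the list `L` are properly colored, `R` is the red class. -/
def St (G : SimpleGraph V) (L : List V) (R : Set V) : Prop :=
  L.Nodup ∧ (∀ x ∈ L, x ∉ R) ∧ ∃ c : V → Fin 5,
    (∀ x, x ∉ L → ∀ y, y ∉ L → G.Adj x y → c x ≠ c y) ∧ ∀ x, x ∉ L → (c x = 0 ↔ x ∈ R)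

theorem St.perm {L L' : List V} {R : Set V} (h : St G L R) (hp : L.Perm L') : St G L' R := by
  obtain ⟨h1, h2, c, h3, h4⟩ := h
  refine ⟨hp.nodup_iff.1 h1, fun x hx => h2 x (hp.mem_iff.2 hx), c, ?_, ?_⟩
  · intro x hx y hy
    exact h3 x (fun h => hx (hp.mem_iff.1 h)) y (fun h => hy (hp.mem_iff.1 h))
  · intro x hx
    exact h4 x (fun h => hx (hp.mem_iff.1 h))

theorem St.addRed {L : List V} {R : Set V} {z : V} (h : St G (z :: L) R)
    (hz : ∀ y, G.Adj z y → y ∉ L → y ∉ R) : St G L (insert z R) := by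
  classical
  obtain ⟨h1, h2, c, h3, h4⟩ := h
  rw [List.nodup_cons] at h1
  refine ⟨h1.2, ?_, fun x => if x = z then 0 else c x, ?_, ?_⟩
  · intro x hx hxr
    rcases hxr with rfl | hxr
    · exact h1.1 hx
    · exact h2 x (List.mem_cons_of_mem _ hx) hxr
  · intro x hx y hy hxy
    simp only
    have key : ∀ y, y ∉ L → G.Adj z y → c y ≠ 0 := by
      intro y hy hzy h0
      refine hz y hzy hy ((h4 y ?_).1 h0)
      rw [List.mem_cons]; rintro (h | h)
      · exact hzy.ne h.symm
      · exact hy h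
    by_cases hxz : x = z
    · subst hxz
      rw [if_pos rfl, if_neg hxy.ne']
      exact (key y hy hxy).symm
    · by_cases hyz : y = z
      · subst hyz
        rw [if_neg hxz, if_pos rfl]
        exact key x hx hxy.symm
      · rw [if_neg hxz, if_neg hyz]
        exact h3 x (by simp [hxz, hx]) y (by simp [hyz, hy]) hxy
  · intro x hx
    by_cases hxz : x = z
    · simp [hxz]
    · simp only [if_neg hxz, Set.mem_insert_iff, hxz, false_or]
      exact h4 x (by simp [hxz, hx])

/-- Assign a free color. -/
theorem St.assign {L : List V} {R : Set V} {z : V} (h1 : (z :: L).Nodup)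
    (h2 : ∀ x ∈ z :: L, x ∉ R) (c : V → Fin 5)
    (h3 : ∀ x, x ∉ z :: L → ∀ y, y ∉ z :: L → G.Adj x y → c x ≠ c y)
    (h4 : ∀ x, x ∉ z :: L → (c x = 0 ↔ x ∈ R)) (e : Fin 5) (he : e ≠ 0)
    (hz : ∀ y, G.Adj z y → y ∉ z :: L → c y ≠ e) : St G L R := by
  classical
  have hn := h1
  rw [List.nodup_cons] at h1
  refine ⟨h1.2, fun x hx => h2 x (List.mem_cons_of_mem _ hx), fun x => if x = z then e else c x, ?_, ?_⟩
  · intro x hx y hy hxy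
    simp only
    by_cases hxz : x = z
    · subst hxz
      rw [if_pos rfl, if_neg hxy.ne']
      exact (hz y hxy (by simp [hxy.ne', hy])).symm
    · by_cases hyz : y = z
      · subst hyz
        rw [if_neg hxz, if_pos rfl]
        exact hz x hxy.symm (by simp [hxz, hx])
      · rw [if_neg hxz, if_neg hyz]
        exact h3 x (by simp [hxz, hx]) y (by simp [hyz, hy]) hxy
  · intro x hx
    by_cases hxz : x = z
    · subst hxz
      simp [he, h2 x]
    · simp only [if_neg hxz]
      exact h4 x (by simp [hxz, hx])

/-- Kempe swap. -/
theorem St.swap {L : List V} {R : Set V} {z p r : V} (h1 : (z :: L).Nodup)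
    (h2 : ∀ x ∈ z :: L, x ∉ R) (c : V → Fin 5)
    (h3 : ∀ x, x ∉ z :: L → ∀ y, y ∉ z :: L → G.Adj x y → c x ≠ c y)
    (h4 : ∀ x, x ∉ z :: L → (c x = 0 ↔ x ∈ R))
    (hpr : c p ≠ c r) (hp0 : c p ≠ 0) (hr0 : c r ≠ 0) (hpL : p ∉ z :: L)
    (hp : ∀ y, G.Adj z y → y ∉ z :: L → c y = c p → y = p)
    (hr : ∀ y, G.Adj z y → y ∉ z :: L → c y = c r → y = r)
    (hno : ¬ ConnIn G (fun x => x ∉ z :: L ∧ (c x = c p ∨ c x = c r)) p r) : St G L R := by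
  classical
  let A : V → Prop := fun x => x ∉ z :: L ∧ (c x = c p ∨ c x = c r)
  let K : V → Prop := fun x => ConnIn G A p x
  have hK : ∀ x, K x → A x := by
    intro x hx
    induction hx with
    | refl => exact ⟨hpL, Or.inl rfl⟩
    | tail _ hs _ => exact hs.2.2
  have hKadj : ∀ x y, K x → G.Adj x y → A y → K y := by
    intro x y hx hxy hy
    exact Relation.ReflTransGen.tail hx ⟨hxy, hK x hx, hy⟩
  let sw : Equiv.Perm (Fin 5) := Equiv.swap (c p) (c r)
  let c' : V → Fin 5 := fun x => if K x then sw (c x) else c x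
  have mixed : ∀ x y, y ∉ z :: L → G.Adj x y → K x → ¬ K y → sw (c x) ≠ c y := by
    intro x y hy hxy hx hny h
    apply hny
    apply hKadj x y hx hxy
    refine ⟨hy, ?_⟩
    rcases (hK x hx).2 with h5 | h5
    · rw [← h, h5]; right; exact Equiv.swap_apply_left _ _
    · rw [← h, h5]; left; exact Equiv.swap_apply_right _ _
  refine St.assign h1 h2 c' ?_ ?_ (c p) hp0 ?_
  · intro x hx y hy hxy
    simp only [c']
    by_cases hx' : K x <;> by_cases hy' : K y
    · rw [if_pos hx', if_pos hy']
      exact fun h => h3 x hx y hy hxy (sw.injective h)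
    · rw [if_pos hx', if_neg hy']
      exact mixed x y hy hxy hx' hy'
    · rw [if_neg hx', if_pos hy']
      exact (mixed y x hx hxy.symm hy' hx').symm
    · rw [if_neg hx', if_neg hy']
      exact h3 x hx y hy hxy
  · intro x hx
    rw [← h4 x hx]
    simp only [c']
    split_ifs with hx'
    · rcases (hK x hx').2 with h5 | h5
      · rw [h5]; simp only [sw, Equiv.swap_apply_left, hp0, hr0]
      · rw [h5]; simp only [sw, Equiv.swap_apply_right, hp0, hr0]
    · rfl
  · intro y hzy hy h
    simp only [c'] at h
    split_ifs at h with hy'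
    · rcases (hK y hy').2 with h5 | h5
      · rw [h5] at h; simp only [sw, Equiv.swap_apply_left] at h; exact hpr h.symm
      · have := hr y hzy hy h5
        subst this
        exact hno hy'
    · have := hp y hzy hy h
      subst this
      exact hy' Relation.ReflTransGen.refl

theorem St.kempe [Fintype V] (hT : IsPlaneTriangulation G σ) {L : List V} {R : Set V} {z : V}
    (h : St G (z :: L) R) (B : List V) (hB : B.Nodup) (hBz : ∀ b ∈ B, G.Adj z b ∧ (b ∈ L ∨ b ∈ R))
    (hd : deg G z ≤ B.length + 4) : St G L R := by
  classical
  obtain ⟨h1, h2, c, h3, h4⟩ := h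
  by_cases hex : ∃ e : Fin 5, e ≠ 0 ∧ ∀ y, G.Adj z y → y ∉ z :: L → c y ≠ e
  · obtain ⟨e, he, hz⟩ := hex
    exact St.assign h1 h2 c h3 h4 e he hz
  push Not at hex
  have hne0 : Nonempty V := ⟨z⟩
  choose! f hf using hex
  have hfl : ∀ e ≠ 0, G.Adj z (f e) := fun e he => (hf e he).1
  have hfL : ∀ e ≠ 0, f e ∉ z :: L := fun e he => (hf e he).2.1
  have hfc : ∀ e ≠ 0, c (f e) = e := fun e he => (hf e he).2.2
  have hne : ∀ e ≠ 0, ∀ e' ≠ 0, e ≠ e' → f e ≠ f e' := by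
    intro e he e' he' hee h
    exact hee (by rw [← hfc e he, h, hfc e' he'])
  have hBc : ∀ b ∈ B, b ∉ z :: L → c b = 0 := by
    intro b hb hbL
    rcases (hBz b hb).2 with h | h
    · exact absurd (List.mem_cons_of_mem _ h) hbL
    · exact (h4 b hbL).2 h
  have hfB : ∀ e ≠ 0, f e ∉ B := by
    intro e he hb
    have := hBc _ hb (hfL e he)
    rw [hfc e he] at this
    exact he this
  have n1 : (1 : Fin 5) ≠ 0 := by decide
  have n2 : (2 : Fin 5) ≠ 0 := by decide
  have n3 : (3 : Fin 5) ≠ 0 := by decide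
  have n4 : (4 : Fin 5) ≠ 0 := by decide
  have m12 := hne 1 n1 2 n2 (by decide)
  have m13 := hne 1 n1 3 n3 (by decide)
  have m14 := hne 1 n1 4 n4 (by decide)
  have m23 := hne 2 n2 3 n3 (by decide)
  have m24 := hne 2 n2 4 n4 (by decide)
  have m34 := hne 3 n3 4 n4 (by decide)
  have hnod : (f 1 :: f 2 :: f 3 :: f 4 :: B).Nodup := by
    simp only [List.nodup_cons, List.mem_cons, not_or]
    exact ⟨⟨m12, m13, m14, hfB 1 n1⟩, ⟨m23, m24, hfB 2 n2⟩, ⟨m34, hfB 3 n3⟩, hfB 4 n4, hB⟩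
  have hsub : (f 1 :: f 2 :: f 3 :: f 4 :: B).toFinset ⊆ (G.neighborFinset z) := by
    intro y hy
    rw [List.mem_toFinset] at hy
    simp only [List.mem_cons] at hy
    rw [SimpleGraph.mem_neighborFinset]
    rcases hy with h | h | h | h | h
    · rw [h]; exact hfl 1 n1
    · rw [h]; exact hfl 2 n2
    · rw [h]; exact hfl 3 n3
    · rw [h]; exact hfl 4 n4
    · exact (hBz y h).1
  have hcard : (G.neighborFinset z).card ≤ (f 1 :: f 2 :: f 3 :: f 4 :: B).toFinset.card := by
    rw [List.toFinset_card_of_nodup hnod]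
    have : (G.neighborFinset z).card = deg G z := by
      rw [deg, Nat.card_eq_fintype_card, SimpleGraph.card_neighborFinset_eq_degree,
        SimpleGraph.card_neighborSet_eq_degree]
    rw [this]
    simp only [List.length_cons]
    omega
  have heq := Finset.eq_of_subset_of_card_le hsub hcard
  have huniq : ∀ e ≠ 0, ∀ y, G.Adj z y → y ∉ z :: L → c y = c (f e) → y = f e := by
    intro e he y hzy hy hcy
    rw [hfc e he] at hcy
    have : y ∈ G.neighborFinset z := by rw [SimpleGraph.mem_neighborFinset]; exact hzy
    rw [← heq, List.mem_toFinset] at this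
    simp only [List.mem_cons] at this
    rcases this with h | h | h | h | h
    · rw [h, hfc 1 n1] at hcy; rw [h, hcy]
    · rw [h, hfc 2 n2] at hcy; rw [h, hcy]
    · rw [h, hfc 3 n3] at hcy; rw [h, hcy]
    · rw [h, hfc 4 n4] at hcy; rw [h, hcy]
    · exfalso; exact he (by rw [← hcy, hBc y h hy])
  -- crossing argument
  have main : ∀ p q r s : Fin 5, p ≠ 0 → q ≠ 0 → r ≠ 0 → s ≠ 0 → p ≠ r → q ≠ s → p ≠ q → p ≠ s →
      q ≠ r → r ≠ s → Cr G z (f p) (f q) (f r) (f s) → St G L R := by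
    intro p q r s hp hq hr hs hpr hqs hpq hps hqr hrs hcr
    by_cases hA : ConnIn G (fun x => x ∉ z :: L ∧ (c x = c (f p) ∨ c x = c (f r))) (f p) (f r)
    · by_cases hB : ConnIn G (fun x => x ∉ z :: L ∧ (c x = c (f q) ∨ c x = c (f s))) (f q) (f s)
      · exfalso
        refine hcr _ _ ?_ ?_ ?_ ?_ ?_ ?_ ?_ hA hB
        · rintro x ⟨_, hx⟩ ⟨_, hx'⟩
          rw [hfc p hp, hfc r hr] at hx
          rw [hfc q hq, hfc s hs] at hx'
          rcases hx with h | h <;> rcases hx' with h' | h' <;> rw [h] at h'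
          · exact hpq h'
          · exact hps h'
          · exact hqr h'.symm
          · exact hrs h'
        · simp
        · simp
        · exact ⟨hfL p hp, Or.inl rfl⟩
        · exact ⟨hfL r hr, Or.inr rfl⟩
        · exact ⟨hfL q hq, Or.inl rfl⟩
        · exact ⟨hfL s hs, Or.inr rfl⟩
      · refine St.swap h1 h2 c h3 h4 ?_ ?_ ?_ (hfL q hq) (huniq q hq) (huniq s hs) hB
        · rw [hfc q hq, hfc s hs]; exact hqs
        · rw [hfc q hq]; exact hq
        · rw [hfc s hs]; exact hs
    · refine St.swap h1 h2 c h3 h4 ?_ ?_ ?_ (hfL p hp) (huniq p hp) (huniq r hr) hA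
      · rw [hfc p hp, hfc r hr]; exact hpr
      · rw [hfc p hp]; exact hp
      · rw [hfc r hr]; exact hr
  rcases four_nbrs hT (hfl 1 n1) (hfl 2 n2) (hfl 3 n3) (hfl 4 n4) m12 m13 m14 m23 m24 m34 with h | h | h
  · exact main 1 2 3 4 n1 n2 n3 n4 (by decide) (by decide) (by decide) (by decide) (by decide) (by decide) h
  · exact main 1 3 2 4 n1 n3 n2 n4 (by decide) (by decide) (by decide) (by decide) (by decide) (by decide) h
  · exact main 1 2 4 3 n1 n2 n4 n3 (by decide) (by decide) (by decide) (by decide) (by decide) (by decide) h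
end RS

namespace RS
variable {G : SimpleGraph V} {σ : Equiv.Perm G.Dart}

theorem St.final [Fintype V] (hG : IsMinimalCounterexample G σ) {R : Set V} (h : St G [] R)
    (hR : 6 * R.ncard ≤ Fintype.card V) : False := by
  obtain ⟨_, _, c, h3, h4⟩ := h
  refine hG.2.1 ⟨c, fun x y hxy => h3 x (by simp) y (by simp) hxy, 0, ?_⟩
  have : {v : V | c v = 0} = R := by
    ext x; exact h4 x (by simp)
  rw [this]; exact hR

theorem St.lift [Fintype V] (hG : IsMinimalCounterexample G σ) {L : List V} (hL : L.Nodup)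
    (W : Type) [Fintype W] (H : SimpleGraph W) (hpl : IsPlanar H)
    (hcard : Fintype.card W < Fintype.card V) (f : {x // x ∉ L} → W)
    (hf : ∀ x y, G.Adj x.1 y.1 → H.Adj (f x) (f y)) :
    ∃ R : Set V, St G L R ∧ ∃ K : Set W, 6 * K.ncard ≤ Fintype.card W ∧
      ∀ x (hx : x ∉ L), (x ∈ R ↔ f ⟨x, hx⟩ ∈ K) := by
  classical
  obtain ⟨c, hc, k, hk⟩ := hG.2.2 W H hpl hcard
  refine ⟨{x | ∃ hx : x ∉ L, c (f ⟨x, hx⟩) = k}, ⟨hL, ?_, ?_⟩, {w | c w = k}, hk, ?_⟩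
  · rintro x hx ⟨hx', _⟩
    exact hx' hx
  · refine ⟨fun x => if hx : x ∉ L then Equiv.swap 0 k (c (f ⟨x, hx⟩)) else 0, ?_, ?_⟩
    · intro x hx y hy hxy
      simp only [hx, hy, not_false_eq_true, dif_pos]
      intro h
      exact hc (hf ⟨x, hx⟩ ⟨y, hy⟩ hxy) ((Equiv.swap 0 k).injective h)
    · intro x hx
      simp only [hx, not_false_eq_true, dif_pos]
      constructor
      · intro h
        refine ⟨hx, ?_⟩
        exact (Equiv.swap 0 k).injective (h.trans (Equiv.swap_apply_right 0 k).symm)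
      · rintro ⟨_, h⟩
        rw [h, Equiv.swap_apply_right]
  · intro x hx
    constructor
    · rintro ⟨_, h⟩; exact h
    · intro h; exact ⟨hx, h⟩

theorem card_notMem [Fintype V] {L : List V} [Fintype {x : V // x ∉ L}] (hL : L.Nodup) :
    Fintype.card {x : V // x ∉ L} + L.length = Fintype.card V := by
  classical
  have h1 : Fintype.card {x : V // x ∈ L} = L.length := by
    rw [Fintype.card_of_subtype L.toFinset (by simp), List.toFinset_card_of_nodup hL]
  have h2 := Fintype.card_subtype_compl (fun x => x ∈ L)
  have h3 := Fintype.card_subtype_le (fun x => x ∈ L)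
  have h4 : Fintype.card {x : V // x ∉ L} = Fintype.card {x : V // ¬ x ∈ L} := by
    apply Fintype.card_congr (Equiv.refl _)
  omega

theorem St.init [Fintype V] (hG : IsMinimalCounterexample G σ) {L : List V} (hL : L.Nodup)
    (hne : L ≠ []) : ∃ R : Set V, St G L R ∧ 6 * R.ncard + L.length ≤ Fintype.card V := by
  classical
  have hc := card_notMem hL
  have hpos := List.length_pos_iff.2 hne
  obtain ⟨R, h1, K, h2, h3⟩ := St.lift hG hL {x // x ∉ L} (G.induce {x | x ∉ L})
    ⟨V, _, G, σ, hG.1, ⟨Subtype.val, fun h => h⟩, Subtype.val_injective⟩ (by omega) id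
    (fun x y h => h)
  refine ⟨R, h1, ?_⟩
  have h4 : R ⊆ Subtype.val '' K := by
    intro x hx
    by_cases hxL : x ∈ L
    · exact absurd hx (h1.2.1 x hxL)
    · exact ⟨⟨x, hxL⟩, (h3 x hxL).1 hx, rfl⟩
  have h5 := Set.ncard_le_ncard h4 (Set.toFinite _)
  have h6 := Set.ncard_image_le (f := Subtype.val) (Set.toFinite K)
  omega

theorem five_le_deg [Fintype V] (hG : IsMinimalCounterexample G σ) (z : V) : 5 ≤ deg G z := by
  by_contra h
  obtain ⟨R, h1, h2⟩ := St.init hG (L := [z]) (by simp) (by simp)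
  exact St.final hG (St.kempe hG.1 h1 [] (by simp) (by simp) (by simp; omega)) (by omega)
end RS

namespace RS
variable {G : SimpleGraph V} {σ : Equiv.Perm G.Dart}

theorem length_le_deg [Fintype V] {z : V} (l : List V) (hl : l.Nodup)
    (h : ∀ y ∈ l, G.Adj z y) : l.length ≤ deg G z := by
  classical
  have hsub : l.toFinset ⊆ G.neighborFinset z := by
    intro y hy
    rw [SimpleGraph.mem_neighborFinset]
    exact h y (List.mem_toFinset.1 hy)
  have h1 := Finset.card_le_card hsub
  rw [List.toFinset_card_of_nodup hl] at h1
  have : (G.neighborFinset z).card = deg G z := by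
    rw [deg, Nat.card_eq_fintype_card, SimpleGraph.card_neighborFinset_eq_degree,
      SimpleGraph.card_neighborSet_eq_degree]
  omega

theorem exists_two [Fintype V] {S : Set V} (hS : Nat.card S = 4) {a b : V} (ha : a ∈ S) (hb : b ∈ S)
    (hab : a ≠ b) : ∃ c d, c ∈ S ∧ d ∈ S ∧ [a, b, c, d].Nodup ∧ ∀ y ∈ S, y ∈ [a, b, c, d] := by
  classical
  have h1 : S.toFinset.card = 4 := by
    rw [Set.toFinset_card, ← Nat.card_eq_fintype_card, hS]
  have h2 : ((S.toFinset.erase a).erase b).card = 2 := by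
    rw [Finset.card_erase_of_mem, Finset.card_erase_of_mem, h1]
    · simpa using ha
    · simp [hb, hab.symm]
  obtain ⟨c, d, hcd, he⟩ := Finset.card_eq_two.1 h2
  have hm : ∀ y, (y ≠ b ∧ y ≠ a ∧ y ∈ S) ↔ (y = c ∨ y = d) := by
    intro y
    have := congrArg (fun s => y ∈ s) he
    simpa using this
  have hc := (hm c).2 (Or.inl rfl)
  have hd := (hm d).2 (Or.inr rfl)
  refine ⟨c, d, hc.2.2, hd.2.2, ?_, ?_⟩
  · simp only [List.nodup_cons, List.mem_cons, List.not_mem_nil, or_false, not_or]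
    exact ⟨⟨hab, hc.2.1.symm, hd.2.1.symm⟩, ⟨hc.1.symm, hd.1.symm⟩, hcd, by simp⟩
  · intro y hy
    simp only [List.mem_cons, List.not_mem_nil, or_false]
    have := hm y
    tauto

theorem exists_one [Fintype V] {S : Set V} (hS : Nat.card S = 4) {a b c : V} (ha : a ∈ S) (hb : b ∈ S)
    (hc : c ∈ S) (hab : a ≠ b) (hac : a ≠ c) (hbc : b ≠ c) :
    ∃ d, d ∈ S ∧ [a, b, c, d].Nodup ∧ ∀ y ∈ S, y ∈ [a, b, c, d] := by
  obtain ⟨p, q, hp, hq, hn, hall⟩ := exists_two hS ha hb hab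
  have hc' := hall c hc
  simp only [List.mem_cons, List.not_mem_nil, or_false] at hc'
  simp only [List.nodup_cons, List.mem_cons, List.not_mem_nil, or_false, not_or] at hn ⊢
  simp only [List.mem_cons, List.not_mem_nil, or_false] at hall
  rcases hc' with h | h | h | h
  · exact absurd h hac.symm
  · exact absurd h hbc.symm
  · subst h; exact ⟨q, hq, hn, hall⟩
  · subst h
    refine ⟨p, hp, ?_, ?_⟩
    · have h1 := hn.1; have h2 := hn.2.1; have h3 := hn.2.2.1
      refine ⟨⟨h1.1, h1.2.2, h1.2.1⟩, ⟨h2.2, h2.1⟩, fun h => h3 h.symm, by simp⟩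
    · intro y hy
      have := hall y hy
      tauto

theorem next_fun (h : IsRotationSystem G σ) {v a b c : V} (h1 : NextNbr σ v a b)
    (h2 : NextNbr σ v a c) : b = c := by
  obtain ⟨p, hp⟩ := h1
  obtain ⟨q, hq⟩ := h2
  rw [← hp, ← hq]

theorem next_inj (h : IsRotationSystem G σ) {v a b c : V} (h1 : NextNbr σ v b a)
    (h2 : NextNbr σ v c a) : b = c := by
  obtain ⟨p, p', hp⟩ := (nextNbr_iff h).1 h1
  obtain ⟨q, q', hq⟩ := (nextNbr_iff h).1 h2
  have := σ.injective (hp.trans hq.symm)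
  exact congrArg (fun d : G.Dart => d.toProd.2) this

theorem exists_next (h : IsRotationSystem G σ) {v a : V} (ha : G.Adj v a) :
    ∃ b, NextNbr σ v a b := ⟨_, ha, rfl⟩

theorem exists_prev (h : IsRotationSystem G σ) {v a : V} (ha : G.Adj v a) :
    ∃ b, NextNbr σ v b a := by
  obtain ⟨d, hd⟩ : ∃ d, d = σ.symm ⟨(v, a), ha⟩ := ⟨_, rfl⟩
  have h1 : σ d = ⟨(v, a), ha⟩ := by rw [hd]; simp
  have h2 : d.toProd.1 = v := by rw [← h.fst_eq, h1]
  obtain ⟨⟨p, q⟩, hpq⟩ := d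
  simp only at h2
  subst h2
  exact ⟨q, hpq, by rw [h1]⟩

theorem next_left (h : IsRotationSystem G σ) {v a b : V} (h1 : NextNbr σ v a b) : G.Adj v a :=
  h1.1
theorem next_right (h : IsRotationSystem G σ) {v a b : V} (h1 : NextNbr σ v a b) : G.Adj v b := by
  obtain ⟨p, p', hp⟩ := (nextNbr_iff h).1 h1
  exact p'

theorem next_pow (h : IsRotationSystem G σ) {v : V} {a b c : V} (ha : G.Adj v a) (k : ℕ)
    (h1 : ((σ ^ k) ⟨(v, a), ha⟩).toProd.2 = b) (h2 : NextNbr σ v b c) :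
    ((σ ^ (k + 1)) ⟨(v, a), ha⟩).toProd.2 = c := by
  have hf := fst_pow h k ⟨(v, a), ha⟩
  obtain ⟨p, hp⟩ := h2
  have : (σ ^ k) ⟨(v, a), ha⟩ = ⟨(v, b), p⟩ := SimpleGraph.Dart.ext _ _ (Prod.ext hf h1)
  rw [pow_succ', Equiv.Perm.mul_apply, this, hp]

theorem pow_snd_inj [Finite V] (h : IsRotationSystem G σ) {v : V} {a : V} (ha : G.Adj v a) {i j : ℕ}
    (hi : i < deg G v) (hj : j < deg G v)
    (hij : ((σ ^ i) ⟨(v, a), ha⟩).toProd.2 = ((σ ^ j) ⟨(v, a), ha⟩).toProd.2) : i = j := by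
  apply pow_inj h ⟨(v, a), ha⟩ hi hj
  exact SimpleGraph.Dart.ext _ _ (Prod.ext (by rw [fst_pow h, fst_pow h]) hij)

theorem next_ne2 [Finite V] (h : IsRotationSystem G σ) {v : V} (hd : 3 ≤ deg G v) {a b c : V}
    (h1 : NextNbr σ v a b) (h2 : NextNbr σ v b c) : a ≠ b ∧ b ≠ c ∧ a ≠ c := by
  have ha := h1.1
  have e0 : ((σ ^ 0) ⟨(v, a), ha⟩).toProd.2 = a := by simp
  have e1 := next_pow h ha 0 e0 h1
  have e2 := next_pow h ha 1 e1 h2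
  refine ⟨?_, ?_, ?_⟩
  · intro hh
    have := pow_snd_inj h ha (i := 0) (j := 1) (by omega) (by omega) (by rw [e0, e1, hh])
    omega
  · intro hh
    have := pow_snd_inj h ha (i := 1) (j := 2) (by omega) (by omega) (by rw [e1, e2, hh])
    omega
  · intro hh
    have := pow_snd_inj h ha (i := 0) (j := 2) (by omega) (by omega) (by rw [e0, e2, hh])
    omega

theorem ncard_insert_le' [Fintype V] (R : Set V) (x : V) : (insert x R).ncard ≤ R.ncard + 1 :=
  Set.ncard_insert_le x R

theorem caseI [Fintype V] (hG : IsMinimalCounterexample G σ) (v u w w' : V)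
    (hv : deg G v = 7)
    (h4 : Nat.card {y : V | G.Adj v y ∧ deg G y = 5} = 4)
    (hnext : NextNbr σ v u w) (hprev : NextNbr σ v w' u)
    (hdw : deg G w = 5) (hdw' : deg G w' = 5) (hu6 : 6 ≤ deg G u) (hu8 : deg G u ≤ 8) : False := by
  classical
  have hT := hG.1
  have hr := hT.rot
  have hf := hT.face_size_eq
  have hvu := hnext.1
  have hvw := next_right hr hnext
  have hvw' := hprev.1
  have huw : G.Adj u w := next_adj hr hf hnext
  have huw' : G.Adj u w' := (next_adj hr hf hprev).symm
  obtain ⟨-, -, hww⟩ := next_ne2 hr (by omega) hprev hnext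
  obtain ⟨x, x', hx, hx', hnd, hall⟩ := exists_two h4 (a := w) (b := w') ⟨hvw, hdw⟩ ⟨hvw', hdw'⟩ hww.symm
  obtain ⟨hvx, hdx⟩ := hx
  obtain ⟨hvx', hdx'⟩ := hx'
  have hux : u ≠ x := by rintro rfl; omega
  have hux' : u ≠ x' := by rintro rfl; omega
  have hLn : [v, u, w, w', x, x'].Nodup := by
    simp only [List.nodup_cons, List.mem_cons, List.not_mem_nil, or_false, not_or] at hnd ⊢
    exact ⟨⟨hvu.ne, hvw.ne, hvw'.ne, hvx.ne, hvx'.ne⟩, ⟨huw.ne, huw'.ne, hux, hux'⟩, hnd⟩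
  have hndx := hnd
  simp only [List.nodup_cons, List.mem_cons, List.not_mem_nil, or_false, not_or] at hndx
  obtain ⟨⟨hww1, hwx, hwx'⟩, ⟨hw'x, hwpx⟩, hxx', -⟩ := hndx
  obtain ⟨R, hSt, hRc⟩ := St.init hG hLn (by simp)
  simp only [List.length_cons, List.length_nil] at hRc
  have hRL := hSt.2.1
  simp only [List.mem_cons, List.not_mem_nil, or_false, forall_eq_or_imp, forall_eq] at hRL
  obtain ⟨rv, ru, rw_, rw', rx, rx'⟩ := hRL
  have fin1 : ∀ z : V, 6 * (insert z R).ncard ≤ Fintype.card V := by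
    intro z
    have := ncard_insert_le' R z
    omega
  have one : ∀ {L : List V} {R : Set V} {z b : V}, St G (z :: L) R → deg G z = 5 → G.Adj z b →
      (b ∈ L ∨ b ∈ R) → St G L R := by
    intro L R z b h1 h2 h3 h4
    exact St.kempe hT h1 [b] (by simp) (by simpa using ⟨h3, h4⟩) (by simp; omega)
  by_cases hY : ∃ y, G.Adj v y ∧ y ∈ R
  · obtain ⟨y, hvy, hyR⟩ := hY
    have hyne : ∀ z, z ∉ R → y ≠ z := by rintro z hz rfl; exact hz hyR
    have yv := hyne v rv
    have yu := hyne u ru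
    have yw := hyne w rw_
    have yw' := hyne w' rw'
    have yx := hyne x rx
    have yx' := hyne x' rx'
    by_cases hU : deg G u ≤ 7 ∨ ∃ t, G.Adj u t ∧ t ≠ v ∧ t ≠ w ∧ t ≠ w' ∧ (t = x ∨ t = x' ∨ t ∈ R)
    · -- colour u
      have h0 : St G [u, v, w, w', x, x'] R := hSt.perm (List.Perm.swap _ _ _)
      have h1 : St G [v, w, w', x, x'] R := by
        rcases hU with hU | ⟨t, ht, t1, t2, t3, t4⟩
        · refine St.kempe hT h0 [v, w, w'] ?_ ?_ (by simp; omega)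
          · simp [hvw.ne, hvw'.ne, hww1]
          · simp [hvu.symm, huw, huw']
        · refine St.kempe hT h0 [v, w, w', t] ?_ ?_ (by simp; omega)
          · simp [hvw.ne, hvw'.ne, hww1, t1.symm, t2.symm, t3.symm]
          · simp [hvu.symm, huw, huw', ht, t1, t2, t3]
            rcases t4 with h | h | h
            · exact Or.inl (Or.inl h)
            · exact Or.inl (Or.inr h)
            · exact Or.inr h
      have key : ∀ f' f g1 g2 : V, St G [v, f', f, g1, g2] R →
          (G.Adj v f' ∧ deg G f' = 5) → (G.Adj v f ∧ deg G f = 5) → (G.Adj v g1 ∧ deg G g1 = 5) →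
          (G.Adj v g2 ∧ deg G g2 = 5) → G.Adj f' y → False := by
        rintro f' f g1 g2 hS ⟨a1, b1⟩ ⟨a2, b2⟩ ⟨a3, b3⟩ ⟨a4, b4⟩ hfy
        have hn := hS.1
        have hRL := hS.2.1
        simp only [List.mem_cons, List.not_mem_nil, or_false, forall_eq_or_imp, forall_eq] at hRL
        obtain ⟨-, rf', rf, -, -⟩ := hRL
        have yf' := hyne f' rf'
        have yf := hyne f rf
        simp only [List.nodup_cons, List.mem_cons, List.not_mem_nil, or_false, not_or] at hn
        by_cases ht : ∃ t, G.Adj f t ∧ t ∈ R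
        · obtain ⟨t, ht1, ht2⟩ := ht
          have s1 : St G [g1, g2, v, f', f] R := hS.perm
            (List.Perm.map ![v, f', f, g1, g2] (by decide : ([0, 1, 2, 3, 4] : List (Fin 5)).Perm [3, 4, 0, 1, 2]))
          have s2 := one s1 b3 a3.symm (by simp)
          have s3 := one s2 b4 a4.symm (by simp)
          have s4 : St G [f', f] R := by
            refine St.kempe hT s3 [y, f, f'] ?_ ?_ (by simp; omega)
            · simp [yf, yf', Ne.symm hn.2.1.1]
            · simp [hvy, a1, a2, hyR]
          have s5 := one s4 b1 hfy (Or.inr hyR)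
          have s6 := one s5 b2 ht1 (Or.inr ht2)
          exact St.final hG s6 (by omega)
        · push Not at ht
          have s1 : St G [f, g1, g2, v, f'] R := hS.perm
            (List.Perm.map ![v, f', f, g1, g2] (by decide : ([0, 1, 2, 3, 4] : List (Fin 5)).Perm [2, 3, 4, 0, 1]))
          have s2 := St.addRed s1 (fun z hz _ => ht z hz)
          have s3 := one s2 b3 a3.symm (by simp)
          have s4 := one s3 b4 a4.symm (by simp)
          have s5 : St G [f'] (insert f R) := by
            refine St.kempe hT s4 [y, f, f'] ?_ ?_ (by simp; omega)
            · simp [yf, yf', Ne.symm hn.2.1.1]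
            · simp [hvy, a1, a2, hyR]
          have s6 := one s5 b1 hfy (Or.inr (Or.inr hyR))
          exact St.final hG s6 (fin1 f)
      -- a neighbour of y in F
      have hex : ∃ f', f' ∈ [w, w', x, x'] ∧ G.Adj f' y := by
        obtain ⟨y1, hy1⟩ := exists_next hr hvy
        obtain ⟨y2, hy2⟩ := exists_prev hr hvy
        obtain ⟨n1, n2, n3⟩ := next_ne2 hr (by omega) hy2 hy1
        by_cases m1 : y1 ∈ [w, w', x, x']
        · exact ⟨y1, m1, (next_adj hr hf hy1).symm⟩
        by_cases m2 : y2 ∈ [w, w', x, x']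
        · exact ⟨y2, m2, next_adj hr hf hy2⟩
        exfalso
        have u1 : y1 ≠ u := by
          rintro rfl
          exact yw' (next_inj hr hy1 hprev)
        have u2 : y2 ≠ u := by
          rintro rfl
          exact yw (next_fun hr hy2 hnext)
        have hlen := length_le_deg (G := G) (z := v) [y, y1, y2, u, w, w', x, x'] ?_ ?_
        · simp only [List.length_cons, List.length_nil] at hlen; omega
        · simp only [List.mem_cons, List.not_mem_nil, or_false, not_or] at m1 m2
          simp only [List.nodup_cons, List.mem_cons, List.not_mem_nil, or_false, not_or] at hLn ⊢
          exact ⟨⟨n2, n1.symm, yu, yw, yw', yx, yx'⟩,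
            ⟨n3.symm, u1, m1⟩, ⟨u2, m2⟩, hLn.2⟩
        · simp only [List.mem_cons, List.not_mem_nil, or_false, forall_eq_or_imp, forall_eq]
          exact ⟨hvy, next_right hr hy1, hy2.1, hvu, hvw, hvw', hvx, hvx'⟩
      obtain ⟨f', hf', hfy⟩ := hex
      simp only [List.mem_cons, List.not_mem_nil, or_false] at hf'
      rcases hf' with rfl | rfl | rfl | rfl
      · exact key f' w' x x' h1 ⟨hvw, hdw⟩ ⟨hvw', hdw'⟩ ⟨hvx, hdx⟩ ⟨hvx', hdx'⟩ hfy
      · exact key f' w x x' (h1.perm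
            (List.Perm.map ![v, w, f', x, x'] (by decide : ([0, 1, 2, 3, 4] : List (Fin 5)).Perm [0, 2, 1, 3, 4])))
            ⟨hvw', hdw'⟩ ⟨hvw, hdw⟩ ⟨hvx, hdx⟩ ⟨hvx', hdx'⟩ hfy
      · exact key f' w w' x' (h1.perm
            (List.Perm.map ![v, w, w', f', x'] (by decide : ([0, 1, 2, 3, 4] : List (Fin 5)).Perm [0, 3, 1, 2, 4])))
            ⟨hvx, hdx⟩ ⟨hvw, hdw⟩ ⟨hvw', hdw'⟩ ⟨hvx', hdx'⟩ hfy
      · exact key f' w w' x (h1.perm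
            (List.Perm.map ![v, w, w', x, f'] (by decide : ([0, 1, 2, 3, 4] : List (Fin 5)).Perm [0, 4, 1, 2, 3])))
            ⟨hvx', hdx'⟩ ⟨hvw, hdw⟩ ⟨hvw', hdw'⟩ ⟨hvx, hdx⟩ hfy
    · push Not at hU
      have s0 : St G [u, x, x', w', v, w] R := hSt.perm
        (List.Perm.map ![v, u, w, w', x, x'] (by decide : ([0, 1, 2, 3, 4, 5] : List (Fin 6)).Perm [1, 4, 5, 3, 0, 2]))
      have s1 := St.addRed s0 (fun t ht _ htR => (hU.2 t ht (by rintro rfl; exact rv htR)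
        (by rintro rfl; exact rw_ htR) (by rintro rfl; exact rw' htR)).2.2 htR)
      have s2 := one s1 hdx hvx.symm (by simp)
      have s3 := one s2 hdx' hvx'.symm (by simp)
      have s4 := one s3 hdw' hvw'.symm (by simp)
      have s5 : St G [w] (insert u R) := by
        refine St.kempe hT s4 [u, y, w] ?_ ?_ (by simp; omega)
        · simp [yu.symm, huw.ne, yw]
        · simp [hvy, hvu, hvw, hyR]
      have s6 := one s5 hdw huw.symm (by simp)
      exact St.final hG s6 (fin1 u)
  · push Not at hY
    by_cases hU : deg G u ≤ 7 ∨ ∃ t, G.Adj u t ∧ t ≠ v ∧ t ≠ w ∧ t ≠ w' ∧ (t = x ∨ t = x' ∨ t ∈ R)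
    · have s1 := St.addRed hSt (fun t ht _ => hY t ht)
      have s2 : St G [w, w', x, x'] (insert v R) := by
        rcases hU with hU | ⟨t, ht, t1, t2, t3, t4⟩
        · refine St.kempe hT s1 [v, w, w'] ?_ ?_ (by simp; omega)
          · simp [hvw.ne, hvw'.ne, hww1]
          · simp [hvu.symm, huw, huw']
        · refine St.kempe hT s1 [v, w, w', t] ?_ ?_ (by simp; omega)
          · simp [hvw.ne, hvw'.ne, hww1, t1.symm, t2.symm, t3.symm]
          · simp [hvu.symm, huw, huw', ht, t1, t2, t3]
            rcases t4 with h | h | h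
            · exact Or.inl (Or.inl h)
            · exact Or.inl (Or.inr h)
            · exact Or.inr h
      have s3 := one s2 hdw hvw.symm (by simp)
      have s4 := one s3 hdw' hvw'.symm (by simp)
      have s5 := one s4 hdx hvx.symm (by simp)
      have s6 := one s5 hdx' hvx'.symm (by simp)
      exact St.final hG s6 (fin1 v)
    · push Not at hU
      have s0 : St G [u, x, x', v, w, w'] R := hSt.perm
        (List.Perm.map ![v, u, w, w', x, x'] (by decide : ([0, 1, 2, 3, 4, 5] : List (Fin 6)).Perm [1, 4, 5, 0, 2, 3]))
      have s1 := St.addRed s0 (fun t ht _ htR => (hU.2 t ht (by rintro rfl; exact rv htR)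
        (by rintro rfl; exact rw_ htR) (by rintro rfl; exact rw' htR)).2.2 htR)
      have s2 := one s1 hdx hvx.symm (by simp)
      have s3 := one s2 hdx' hvx'.symm (by simp)
      have s5 : St G [w, w'] (insert u R) := by
        refine St.kempe hT s3 [u, w, w'] ?_ ?_ (by simp; omega)
        · simp [huw'.ne, huw.ne, hww1]
        · simp [hvu, hvw, hvw']
      have s6 := one s5 hdw huw.symm (by simp)
      have s7 := one s6 hdw' huw'.symm (by simp)
      exact St.final hG s7 (fin1 u)
end RS

namespace RS

/-- A triangulated plane multigraph map carried by the set `L` of live darts. -/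
structure TML {D W : Type} (L : Set D) (α φ : D → D) (lab : D → W) : Prop where
  aL : ∀ d ∈ L, α d ∈ L
  pL : ∀ d ∈ L, φ d ∈ L
  inv : ∀ d ∈ L, α (α d) = d
  cube : ∀ d ∈ L, φ (φ (φ d)) = d
  labp : ∀ d ∈ L, lab (φ d) = lab (α d)
  ne : ∀ d ∈ L, lab d ≠ lab (α d)
  orb : ∀ P : D → Prop, (∀ d ∈ L, P d → P (φ (α d))) → ∀ d ∈ L, ∀ e ∈ L, lab d = lab e → P d → P e
  euler : L.ncard + 12 = 6 * (lab '' L).ncard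
  conn : ∀ P : W → Prop, (∀ d ∈ L, P (lab d) → P (lab (α d))) → ∀ d ∈ L, ∀ e ∈ L, P (lab d) → P (lab e)

open Classical in
/-- new edge involution after contracting -/
noncomputable def calpha {D : Type} (α : D → D) (f g f' g' : D) (d : D) : D :=
  if d = α f then α g else if d = α g then α f else
  if d = α f' then α g' else if d = α g' then α f' else α d

open Classical in
/-- renaming y to x -/
noncomputable def mer {W : Type} (x y : W) (t : W) : W := if t = y then x else t

set_option maxHeartbeats 4000000 in
theorem contract {D W : Type} [Finite D] {L : Set D} {α φ : D → D} {lab : D → W}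
    (h : TML L α φ lab) {e : D} (he : e ∈ L)
    (huniq : ∀ d ∈ L, lab d = lab e → lab (α d) = lab (α e) → d = e)
    (hx : ∃ d1 ∈ L, ∃ d2 ∈ L, lab d1 = lab e ∧ lab d2 = lab e ∧ lab (α d1) ≠ lab (α e) ∧
      lab (α d2) ≠ lab (α e) ∧ lab (α d1) ≠ lab (α d2))
    (hy : ∃ d1 ∈ L, ∃ d2 ∈ L, lab d1 = lab (α e) ∧ lab d2 = lab (α e) ∧ lab (α d1) ≠ lab e ∧
      lab (α d2) ≠ lab e ∧ lab (α d1) ≠ lab (α d2)) :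
    ∃ (L' : Set D) (α' : D → D), L' ⊆ L ∧ TML L' α' φ (fun d => mer (lab e) (lab (α e)) (lab d)) ∧
      (∀ d ∈ L', mer (lab e) (lab (α e)) (lab (α' d)) = mer (lab e) (lab (α e)) (lab (α d))) ∧
      (∀ d ∈ L, mer (lab e) (lab (α e)) (lab d) ≠ mer (lab e) (lab (α e)) (lab (α d)) →
        ∃ d' ∈ L', mer (lab e) (lab (α e)) (lab d') = mer (lab e) (lab (α e)) (lab d) ∧
          mer (lab e) (lab (α e)) (lab (α' d')) = mer (lab e) (lab (α e)) (lab (α d))) := by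
  classical
  obtain ⟨aL, pL, inv, cube, labp, ne, orb, euler, conn⟩ := h
  obtain ⟨x, hxe⟩ : ∃ x, x = lab e := ⟨_, rfl⟩
  obtain ⟨e', he'⟩ : ∃ e', e' = α e := ⟨_, rfl⟩
  obtain ⟨y, hye⟩ : ∃ y, y = lab e' := ⟨_, rfl⟩
  obtain ⟨f, hf⟩ : ∃ f, f = φ e := ⟨_, rfl⟩
  obtain ⟨g, hg⟩ : ∃ g, g = φ f := ⟨_, rfl⟩
  obtain ⟨f', hf'⟩ : ∃ f', f' = φ e' := ⟨_, rfl⟩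
  obtain ⟨g', hg'⟩ : ∃ g', g' = φ f' := ⟨_, rfl⟩
  obtain ⟨z, hz⟩ : ∃ z, z = lab g := ⟨_, rfl⟩
  obtain ⟨z', hz'⟩ : ∃ z', z' = lab g' := ⟨_, rfl⟩
  rw [← he', ← hye, ← hxe] at huniq hx hy ⊢
  have me' : e' ∈ L := by rw [he']; exact aL e he
  have mf : f ∈ L := by rw [hf]; exact pL e he
  have mg : g ∈ L := by rw [hg]; exact pL f mf
  have mf' : f' ∈ L := by rw [hf']; exact pL e' me'
  have mg' : g' ∈ L := by rw [hg']; exact pL f' mf'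
  have pg : φ g = e := by rw [hg, hf]; exact cube e he
  have pg' : φ g' = e' := by rw [hg', hf']; exact cube e' me'
  have ae' : α e' = e := by rw [he']; exact inv e he
  have lf : lab f = y := by rw [hf, labp e he, ← he', ← hye]
  have laf : lab (α f) = z := by rw [← labp f mf, ← hg, ← hz]
  have lag : lab (α g) = x := by rw [← labp g mg, pg, ← hxe]
  have lf' : lab f' = x := by rw [hf', labp e' me', ae', ← hxe]
  have laf' : lab (α f') = z' := by rw [← labp f' mf', ← hg', ← hz']
  have lag' : lab (α g') = y := by rw [← labp g' mg', pg', ← hye]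
  have xy : x ≠ y := by rw [hxe, hye, he']; exact ne e he
  have yz : y ≠ z := by rw [← lf, ← laf]; exact ne f mf
  have zx : z ≠ x := by rw [hz, ← lag]; exact ne g mg
  have xz' : x ≠ z' := by rw [← lf', ← laf']; exact ne f' mf'
  have z'y : z' ≠ y := by rw [hz', ← lag']; exact ne g' mg'
  have lsig : ∀ d ∈ L, lab (φ (α d)) = lab d := by
    intro d hd
    rw [labp _ (aL d hd), inv d hd]
  have ainj : ∀ d ∈ L, ∀ d' ∈ L, α d = α d' → d = d' := by
    intro d hd d' hd' hdd
    rw [← inv d hd, hdd, inv d' hd']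
  have nd1 : α f ≠ g' := by
    intro hh
    obtain ⟨d1, m1, d2, m2, k1, k2, k3, k4, k5⟩ := hy
    have key := orb (fun d => d = f ∨ d = e') (by
      rintro d hd (rfl | rfl)
      · right; rw [hh, pg']
      · left; rw [ae', hf])
    have c1 := key e' me' d1 m1 (by rw [k1, hye]) (Or.inr rfl)
    have c2 := key e' me' d2 m2 (by rw [k2, hye]) (Or.inr rfl)
    have v1 : d1 = f := by
      rcases c1 with c | c
      · exact c
      · exact absurd (by rw [c, ae', ← hxe]) k3
    have v2 : d2 = f := by
      rcases c2 with c | c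
      · exact c
      · exact absurd (by rw [c, ae', ← hxe]) k4
    exact k5 (by rw [v1, v2])
  have nd2 : α g ≠ f' := by
    intro hh
    have hh' : α f' = g := by rw [← hh, inv g mg]
    obtain ⟨d1, m1, d2, m2, k1, k2, k3, k4, k5⟩ := hx
    have key := orb (fun d => d = f' ∨ d = e) (by
      rintro d hd (rfl | rfl)
      · right; rw [hh', pg]
      · left; rw [← he', hf'])
    have c1 := key e he d1 m1 (by rw [k1, hxe]) (Or.inr rfl)
    have c2 := key e he d2 m2 (by rw [k2, hxe]) (Or.inr rfl)
    have v1 : d1 = f' := by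
      rcases c1 with c | c
      · exact c
      · exact absurd (by rw [c, ← he', ← hye]) k3
    have v2 : d2 = f' := by
      rcases c2 with c | c
      · exact c
      · exact absurd (by rw [c, ← he', ← hye]) k4
    exact k5 (by rw [v1, v2])
  have nd3 : α f' ≠ g := by
    intro hh; exact nd2 (by rw [← hh, inv f' mf'])
  have nd4 : α g' ≠ f := by
    intro hh; exact nd1 (by rw [← hh, inv g' mg'])
  have lne : ∀ {d d' : D}, lab d ≠ lab d' → d ≠ d' := by
    rintro d d' hd rfl; exact hd rfl
  have lane : ∀ {d d' : D}, lab (α d) ≠ lab (α d') → d ≠ d' := by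
    rintro d d' hd rfl; exact hd rfl
  have maf := aL f mf
  have mag := aL g mg
  have maf' := aL f' mf'
  have mag' := aL g' mg'
  have iaf := inv f mf
  have iag := inv g mg
  have iaf' := inv f' mf'
  have iag' := inv g' mg'
  let S : Set D := {e, f, g, e', f', g'}
  have hS : ∀ d, d ∈ S ↔ (d = e ∨ d = f ∨ d = g ∨ d = e' ∨ d = f' ∨ d = g') := by
    intro d; simp [S]
  have naf : α f ∉ S := by
    rw [hS]
    rintro (h | h | h | h | h | h)
    · exact zx (by rw [← laf, h, hxe])
    · exact yz (by rw [← laf, h, lf])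
    · exact xy (by rw [← lag, ← h, iaf, lf])
    · exact yz (by rw [← laf, h, hye])
    · exact zx (by rw [← laf, h, lf'])
    · exact nd1 h
  have nag : α g ∉ S := by
    rw [hS]
    rintro (h | h | h | h | h | h)
    · exact yz (by rw [hye, he', ← h, iag, hz])
    · exact xy (by rw [← lag, h, lf])
    · exact zx (by rw [← lag, h, hz])
    · exact xy (by rw [← lag, h, hye])
    · exact nd2 h
    · exact xz' (by rw [← lag, h, hz'])
  have naf' : α f' ∉ S := by
    rw [hS]
    rintro (h | h | h | h | h | h)
    · exact xz' (by rw [← laf', h, hxe])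
    · exact z'y (by rw [← laf', h, lf])
    · exact nd3 h
    · exact z'y (by rw [← laf', h, hye])
    · exact xz' (by rw [← laf', h, lf'])
    · exact xy (by rw [← lag', ← h, iaf', lf'])
  have nag' : α g' ∉ S := by
    rw [hS]
    rintro (h | h | h | h | h | h)
    · exact xy (by rw [← lag', h, hxe])
    · exact nd4 h
    · exact yz (by rw [← lag', h, hz])
    · exact xz' (by rw [hz', ← iag', h, ae', hxe])
    · exact xy (by rw [← lag', h, lf'])
    · exact z'y (by rw [← lag', h, hz'])
  have nef : e ≠ f := lne (by rw [← hxe, lf]; exact xy)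
  have neg : e ≠ g := lne (by rw [← hxe, ← hz]; exact zx.symm)
  have nee' : e ≠ e' := lne (by rw [← hxe, ← hye]; exact xy)
  have nef' : e ≠ f' := lane (by rw [← he', ← hye, laf']; exact z'y.symm)
  have neg' : e ≠ g' := lne (by rw [← hxe, ← hz']; exact xz')
  have nfg : f ≠ g := lne (by rw [lf, ← hz]; exact yz)
  have nfe' : f ≠ e' := lane (by rw [laf, ae', ← hxe]; exact zx)
  have nff' : f ≠ f' := lne (by rw [lf, lf']; exact xy.symm)
  have nfg' : f ≠ g' := lne (by rw [lf, ← hz']; exact z'y.symm)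
  have nge' : g ≠ e' := lne (by rw [← hz, ← hye]; exact yz.symm)
  have ngf' : g ≠ f' := lne (by rw [← hz, lf']; exact zx)
  have ngg' : g ≠ g' := lane (by rw [lag, lag']; exact xy)
  have nef'' : e' ≠ f' := lne (by rw [← hye, lf']; exact xy.symm)
  have neg'' : e' ≠ g' := lne (by rw [← hye, ← hz']; exact z'y.symm)
  have nfg'' : f' ≠ g' := lne (by rw [lf', ← hz']; exact xz')
  obtain ⟨α', hα'⟩ : ∃ α', α' = calpha α f g f' g' := ⟨_, rfl⟩
  have v1 : α' (α f) = α g := by simp [hα', calpha]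
  have v2 : α' (α g) = α f := by
    have : α g ≠ α f := fun hh => nfg (ainj _ mg _ mf hh).symm
    simp [hα', calpha, this]
  have v3 : α' (α f') = α g' := by
    have h1 : α f' ≠ α f := fun hh => nff' (ainj _ mf' _ mf hh).symm
    have h2 : α f' ≠ α g := fun hh => ngf' (ainj _ mf' _ mg hh).symm
    simp [hα', calpha, h1, h2]
  have v4 : α' (α g') = α f' := by
    have h1 : α g' ≠ α f := fun hh => nfg' (ainj _ mg' _ mf hh).symm
    have h2 : α g' ≠ α g := fun hh => ngg' (ainj _ mg' _ mg hh).symm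
    have h3 : α g' ≠ α f' := fun hh => nfg'' (ainj _ mg' _ mf' hh).symm
    simp [hα', calpha, h1, h2, h3]
  have dcase : ∀ d ∈ L \ S, d = α f ∨ d = α g ∨ d = α f' ∨ d = α g' ∨
      (α' d = α d ∧ α d ∈ L \ S ∧ α' (α d) = d) := by
    rintro d ⟨hd, hdS⟩
    by_cases h1 : d = α f
    · exact Or.inl h1
    by_cases h2 : d = α g
    · exact Or.inr (Or.inl h2)
    by_cases h3 : d = α f'
    · exact Or.inr (Or.inr (Or.inl h3))
    by_cases h4 : d = α g'
    · exact Or.inr (Or.inr (Or.inr (Or.inl h4)))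
    right; right; right; right
    have hS' := hdS
    rw [hS] at hS'
    push Not at hS'
    obtain ⟨s1, s2, s3, s4, s5, s6⟩ := hS'
    refine ⟨by simp [hα', calpha, h1, h2, h3, h4], ⟨aL d hd, ?_⟩, ?_⟩
    · rw [hS]
      rintro (k | k | k | k | k | k)
      · exact s4 (by rw [he', ← k, inv d hd])
      · exact h1 (by rw [← k, inv d hd])
      · exact h2 (by rw [← k, inv d hd])
      · exact s1 (by rw [← ae', ← k, inv d hd])
      · exact h3 (by rw [← k, inv d hd])
      · exact h4 (by rw [← k, inv d hd])
    · have t1 : α d ≠ α f := fun hh => s2 (ainj _ hd _ mf hh)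
      have t2 : α d ≠ α g := fun hh => s3 (ainj _ hd _ mg hh)
      have t3 : α d ≠ α f' := fun hh => s5 (ainj _ hd _ mf' hh)
      have t4 : α d ≠ α g' := fun hh => s6 (ainj _ hd _ mg' hh)
      simp [hα', calpha, t1, t2, t3, t4, inv d hd]
  have laf0 : α f ∈ L \ S := ⟨maf, naf⟩
  have lag0 : α g ∈ L \ S := ⟨mag, nag⟩
  have laf0' : α f' ∈ L \ S := ⟨maf', naf'⟩
  have lag0' : α g' ∈ L \ S := ⟨mag', nag'⟩
  have phiS : ∀ d ∈ S, φ d ∈ S := by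
    intro d hd
    rw [hS] at hd ⊢
    rcases hd with h | h | h | h | h | h
    · right; left; rw [h, hf]
    · right; right; left; rw [h, hg]
    · left; rw [h, pg]
    · right; right; right; right; left; rw [h, hf']
    · right; right; right; right; right; rw [h, hg']
    · right; right; right; left; rw [h, pg']
  have pL' : ∀ d ∈ L \ S, φ d ∈ L \ S := by
    rintro d ⟨hd, hdS⟩
    refine ⟨pL d hd, fun hh => hdS ?_⟩
    rw [← cube d hd]
    exact phiS _ (phiS _ hh)
  obtain ⟨M, hM⟩ : ∃ M, M = mer x y := ⟨_, rfl⟩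
  have My : M y = x := by simp [hM, mer]
  have Mt : ∀ t, t ≠ y → M t = t := by intro t ht; simp [hM, mer, ht]
  have Mx : M x = x := Mt x xy
  have Mny : ∀ t, M t ≠ y := by
    intro t; by_cases ht : t = y
    · rw [ht, My]; exact xy
    · rw [Mt t ht]; exact ht
  have Meq : ∀ s t, M s = M t → s = t ∨ ((s = x ∨ s = y) ∧ (t = x ∨ t = y)) := by
    intro s t hst
    by_cases hs : s = y
    · by_cases ht : t = y
      · exact Or.inl (hs.trans ht.symm)
      · rw [hs, My, Mt t ht] at hst
        exact Or.inr ⟨Or.inr hs, Or.inl hst.symm⟩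
    · by_cases ht : t = y
      · rw [ht, My, Mt s hs] at hst
        exact Or.inr ⟨Or.inl hst, Or.inr ht⟩
      · rw [Mt s hs, Mt t ht] at hst; exact Or.inl hst
  have labM : ∀ d ∈ L \ S, M (lab (α' d)) = M (lab (α d)) := by
    intro d hd
    rcases dcase d hd with h | h | h | h | h
    · rw [h, v1, lag, iaf, lf, Mx, My]
    · rw [h, v2, laf, iag, ← hz]
    · rw [h, v3, lag', iaf', lf', Mx, My]
    · rw [h, v4, laf', iag', ← hz']
    · rw [h.1]
  have neM : ∀ d ∈ L \ S, M (lab d) ≠ M (lab (α d)) := by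
    rintro d ⟨hd, hdS⟩ hh
    rcases Meq _ _ hh with h | ⟨h1, h2⟩
    · exact ne d hd h
    · apply hdS
      rw [hS]
      rcases h1 with h1 | h1
      · rcases h2 with h2 | h2
        · exact absurd (h1.trans h2.symm) (ne d hd)
        · exact Or.inl (huniq d hd h1 h2)
      · rcases h2 with h2 | h2
        · have := huniq (α d) (aL d hd) h2 (by rw [inv d hd, h1])
          right; right; right; left
          rw [he', ← this, inv d hd]
        · exact absurd (h1.trans h2.symm) (ne d hd)
  have real : ∀ d ∈ L, M (lab d) ≠ M (lab (α d)) →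
      ∃ d' ∈ L \ S, M (lab d') = M (lab d) ∧ M (lab (α' d')) = M (lab (α d)) := by
    intro d hd hne
    by_cases hdS : d ∈ S
    · rw [hS] at hdS
      rcases hdS with h | h | h | h | h | h
      · exact absurd (by rw [h, ← he', ← hxe, ← hye, Mx, My]) hne
      · exact ⟨α g, lag0, by rw [h, lag, lf, Mx, My], by rw [v2, h]⟩
      · exact ⟨α f, laf0, by rw [h, laf, ← hz], by rw [v1, h]⟩
      · exact absurd (by rw [h, ae', ← hxe, ← hye, Mx, My]) hne
      · exact ⟨α g', lag0', by rw [h, lag', lf', Mx, My], by rw [v4, h]⟩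
      · exact ⟨α f', laf0', by rw [h, laf', ← hz'], by rw [v3, h]⟩
    · exact ⟨d, ⟨hd, hdS⟩, rfl, labM d ⟨hd, hdS⟩⟩
  rw [← hM]
  refine ⟨L \ S, α', Set.diff_subset, ⟨?_, pL', ?_, fun d hd => cube d hd.1, ?_, ?_, ?_, ?_, ?_⟩,
    labM, real⟩
  · intro d hd
    rcases dcase d hd with h | h | h | h | h
    · rw [h, v1]; exact lag0
    · rw [h, v2]; exact laf0
    · rw [h, v3]; exact lag0'
    · rw [h, v4]; exact laf0'
    · rw [h.1]; exact h.2.1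
  · intro d hd
    rcases dcase d hd with h | h | h | h | h
    · rw [h, v1, v2]
    · rw [h, v2, v1]
    · rw [h, v3, v4]
    · rw [h, v4, v3]
    · rw [h.1]; exact h.2.2
  · intro d hd
    show M _ = M _
    rw [labM d hd, labp d hd.1]
  · intro d hd
    show M _ ≠ M _
    rw [labM d hd]; exact neM d hd
  · -- orbits
    intro P hP d hd d0 hd0 hdd hPd
    have hdd : M (lab d) = M (lab d0) := hdd
    have c2 : P (α g) → P (φ (α f)) := fun hh => by have := hP _ lag0 hh; rwa [v2] at this
    have c1 : P (α f) → P (φ (α g)) := fun hh => by have := hP _ laf0 hh; rwa [v1] at this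
    have c3 : P (α f') → P (φ (α g')) := fun hh => by have := hP _ laf0' hh; rwa [v3] at this
    have c4 : P (α g') → P (φ (α f')) := fun hh => by have := hP _ lag0' hh; rwa [v4] at this
    have sf : φ (α f) ∈ L \ S := pL' _ laf0
    have sf' : φ (α f') ∈ L \ S := pL' _ laf0'
    have nS : ∀ {a}, a ∈ L \ S → a ∈ S → False := fun h1 h2 => h1.2 h2
    have eS : e ∈ S := by simp [S]
    have eS' : e' ∈ S := by simp [S]
    have fS : f ∈ S := by simp [S]
    have fS' : f' ∈ S := by simp [S]
    have X1 : ∀ d ∈ L \ S, lab d = x → P d → P (α g) := by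
      intro d hd hdx hPd
      have key := orb (fun d => lab d = x → P (α g) ∨ (d ∈ L \ S ∧ P d)) (by
        intro d hdL hq hdx
        rw [lsig d hdL] at hdx
        rcases hq hdx with hq | ⟨hd, hPd⟩
        · exact Or.inl hq
        · rcases dcase d hd with h | h | h | h | h
          · exact absurd (by rw [← laf, ← h, hdx]) zx
          · left; rw [← h]; exact hPd
          · exact absurd (by rw [← laf', ← h, hdx]) xz'
          · exact absurd (by rw [← lag', ← h, hdx]) xy
          · right
            exact ⟨pL' _ h.2.1, by have := hP d hd hPd; rwa [h.1] at this⟩)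
        d hd.1 e he (by rw [hdx, hxe]) (fun _ => Or.inr ⟨hd, hPd⟩) hxe.symm
      rcases key with h | h
      · exact h
      · exact absurd eS h.1.2
    have Y1 : ∀ d ∈ L \ S, lab d = y → P d → P (α g') := by
      intro d hd hdx hPd
      have key := orb (fun d => lab d = y → P (α g') ∨ (d ∈ L \ S ∧ P d)) (by
        intro d hdL hq hdx
        rw [lsig d hdL] at hdx
        rcases hq hdx with hq | ⟨hd, hPd⟩
        · exact Or.inl hq
        · rcases dcase d hd with h | h | h | h | h
          · exact absurd (by rw [← laf, ← h, hdx]) yz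
          · exact absurd (by rw [← lag, ← h, hdx]) xy
          · exact absurd (by rw [← laf', ← h, hdx]) z'y
          · left; rw [← h]; exact hPd
          · right
            exact ⟨pL' _ h.2.1, by have := hP d hd hPd; rwa [h.1] at this⟩)
        d hd.1 e' me' (by rw [hdx, hye]) (fun _ => Or.inr ⟨hd, hPd⟩) hye.symm
      rcases key with h | h
      · exact h
      · exact absurd eS' h.1.2
    have lsf : lab (φ (α f)) = y := by rw [lsig f mf, lf]
    have lsf' : lab (φ (α f')) = x := by rw [lsig f' mf', lf']
    have X2 : P (α g) → P (α g') := fun h => Y1 _ sf lsf (c2 h)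
    have Y2 : P (α g') → P (α g) := fun h => X1 _ sf' lsf' (c4 h)
    have X3 : P (α g) → ∀ d ∈ L \ S, lab d = x → P d := by
      intro hg0 d hd hdx
      have h4 := c4 (X2 hg0)
      refine orb (fun d => lab d = x → d ∈ L \ S → P d) ?_ e he d hd.1 (by rw [hdx, hxe])
        (fun _ hh => absurd eS hh.2) hdx hd
      intro d hdL hq hdx hsd
      rw [lsig d hdL] at hdx
      by_cases hdS : d ∈ S
      · rw [hS] at hdS
        rcases hdS with h | h | h | h | h | h
        · exfalso; rw [h, ← he', ← hf'] at hsd; exact hsd.2 fS'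
        · exact absurd (by rw [← lf, ← h, hdx]) xy
        · exact absurd (by rw [hz, ← h, hdx]) zx
        · exact absurd (by rw [hye, ← h, hdx]) xy
        · rw [h]; exact h4
        · exact absurd (by rw [hz', ← h, hdx]) xz'
      · have hd : d ∈ L \ S := ⟨hdL, hdS⟩
        rcases dcase d hd with h | h | h | h | h
        · exact absurd (by rw [← laf, ← h, hdx]) zx
        · exfalso; rw [h, iag, pg] at hsd; exact hsd.2 eS
        · exact absurd (by rw [← laf', ← h, hdx]) xz'
        · exact absurd (by rw [← lag', ← h, hdx]) xy
        · have := hP d hd (hq hdx hd); rwa [h.1] at this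
    have Y3 : P (α g) → ∀ d ∈ L \ S, lab d = y → P d := by
      intro hg0 d hd hdx
      have h4 := c2 hg0
      refine orb (fun d => lab d = y → d ∈ L \ S → P d) ?_ e' me' d hd.1 (by rw [hdx, hye])
        (fun _ hh => absurd eS' hh.2) hdx hd
      intro d hdL hq hdx hsd
      rw [lsig d hdL] at hdx
      by_cases hdS : d ∈ S
      · rw [hS] at hdS
        rcases hdS with h | h | h | h | h | h
        · exact absurd (by rw [hxe, ← h, hdx]) xy
        · rw [h]; exact h4
        · exact absurd (by rw [hz, ← h, hdx]) yz
        · exfalso; rw [h, ae', ← hf] at hsd; exact hsd.2 fS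
        · exact absurd (by rw [← lf', ← h, hdx]) xy
        · exact absurd (by rw [hz', ← h, hdx]) z'y
      · have hd : d ∈ L \ S := ⟨hdL, hdS⟩
        rcases dcase d hd with h | h | h | h | h
        · exact absurd (by rw [← laf, ← h, hdx]) yz
        · exact absurd (by rw [← lag, ← h, hdx]) xy
        · exact absurd (by rw [← laf', ← h, hdx]) z'y
        · exfalso; rw [h, iag', pg'] at hsd; exact hsd.2 eS'
        · have := hP d hd (hq hdx hd); rwa [h.1] at this
    have toG : (lab d = x ∨ lab d = y) → P (α g) := by
      rintro (h | h)
      · exact X1 d hd h hPd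
      · exact Y2 (Y1 d hd h hPd)
    by_cases hxy : lab d = x ∨ lab d = y
    · have h0 : lab d0 = x ∨ lab d0 = y := by
        rcases Meq _ _ hdd with h | h
        · rwa [← h]
        · exact h.2
      rcases h0 with h0 | h0
      · exact X3 (toG hxy) d0 hd0 h0
      · exact Y3 (toG hxy) d0 hd0 h0
    · have h0 : lab d = lab d0 := by
        rcases Meq _ _ hdd with h | h
        · exact h
        · exact absurd h.1 hxy
      push Not at hxy
      obtain ⟨hdx, hdy⟩ := hxy
      have lsg : φ (α g) ∈ L \ S := pL' _ lag0
      have lsg' : φ (α g') ∈ L \ S := pL' _ lag0'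
      have key := orb (fun d => lab d ≠ x → lab d ≠ y →
          (d = g ∧ P (α f)) ∨ (d = g' ∧ P (α f')) ∨ (d ∈ L \ S ∧ P d)) (by
        intro d hdL hq hdx hdy
        rw [lsig d hdL] at hdx hdy
        rcases hq hdx hdy with ⟨h, hq⟩ | ⟨h, hq⟩ | ⟨hd, hq⟩
        · right; right; rw [h]; exact ⟨lsg, c1 hq⟩
        · right; right; rw [h]; exact ⟨lsg', c3 hq⟩
        · rcases dcase d hd with h | h | h | h | h
          · left; rw [h, iaf, ← hg]; exact ⟨rfl, by rwa [h] at hq⟩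
          · exact absurd (by rw [h, lag]) hdx
          · right; left; rw [h, iaf', ← hg']; exact ⟨rfl, by rwa [h] at hq⟩
          · exact absurd (by rw [h, lag']) hdy
          · right; right
            exact ⟨pL' _ h.2.1, by have := hP d hd hq; rwa [h.1] at this⟩)
        d hd.1 d0 hd0.1 h0 (fun _ _ => Or.inr (Or.inr ⟨hd, hPd⟩)) (h0 ▸ hdx) (h0 ▸ hdy)
      rcases key with h | h | h
      · exact absurd (by rw [h.1]; simp [S]) hd0.2
      · exact absurd (by rw [h.1]; simp [S]) hd0.2
      · exact h.2
  · -- euler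
    have hSL : S ⊆ L := by
      intro d hd
      rw [hS] at hd
      rcases hd with h | h | h | h | h | h <;> rw [h] <;> assumption
    have hSc : S.ncard = 6 := by
      have : S = ((({e, f, g, e', f', g'} : Finset D)) : Set D) := by simp [S]
      rw [this, Set.ncard_coe_finset]
      rw [Finset.card_insert_of_notMem, Finset.card_insert_of_notMem,
        Finset.card_insert_of_notMem, Finset.card_insert_of_notMem, Finset.card_insert_of_notMem,
        Finset.card_singleton] <;>
      simp [nef, neg, nee', nef', neg', nfg, nfe', nff', nfg', nge', ngf', ngg', nef'', neg'',
        nfg'']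
    have himg : (fun d => M (lab d)) '' (L \ S) = (lab '' L) \ {y} := by
      ext t
      constructor
      · rintro ⟨d, hd, rfl⟩
        refine ⟨?_, Mny _⟩
        by_cases hdy : lab d = y
        · exact ⟨e, he, by simp only [hdy, My, ← hxe]⟩
        · exact ⟨d, hd.1, by simp only [Mt _ hdy]⟩
      · rintro ⟨⟨d, hd, rfl⟩, hdy⟩
        have hdy : lab d ≠ y := hdy
        by_cases hdS : d ∈ S
        · rw [hS] at hdS
          rcases hdS with h | h | h | h | h | h
          · exact ⟨α g, lag0, by simp only [lag, Mx, h, ← hxe]⟩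
          · exact absurd (by rw [h, lf]) hdy
          · exact ⟨α f, laf0, by simp only [laf, Mt z yz.symm, h, ← hz]⟩
          · exact absurd (by rw [h, hye]) hdy
          · exact ⟨α g, lag0, by simp only [lag, Mx, h, lf']⟩
          · exact ⟨α f', laf0', by simp only [laf', Mt z' z'y, h, ← hz']⟩
        · exact ⟨d, ⟨hd, hdS⟩, by simp only [Mt _ hdy]⟩
    have hyL : y ∈ lab '' L := ⟨e', me', hye.symm⟩
    have e1 := Set.ncard_diff_add_ncard_of_subset hSL (Set.toFinite _)
    have e2 := Set.ncard_diff_singleton_add_one hyL (Set.toFinite _)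
    show _ = 6 * ((fun d => M (lab d)) '' (L \ S)).ncard
    rw [himg]
    omega
  · intro P hP d hd d0 hd0 hPd
    refine conn (fun t => P (M t)) ?_ d hd.1 d0 hd0.1 hPd
    intro d hd hPd
    by_cases hh : M (lab d) = M (lab (α d))
    · show P (M (lab (α d)))
      rw [← hh]; exact hPd
    · obtain ⟨d', hd', k1, k2⟩ := real d hd hh
      have := hP d' hd' (by show P (M (lab d')); rw [k1]; exact hPd)
      show P (M (lab (α d)))
      rw [← k2]; exact this
end RS

namespace RS

theorem card_three {D : Type} [Finite D] (f : Equiv.Perm D)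
    (h : ∀ d, Nat.card {e // f.SameCycle d e} = 3) :
    Nat.card D = 3 * Nat.card (Quotient (orbitSetoid f)) := by
  classical
  letI : Fintype (Quotient (orbitSetoid f)) := Fintype.ofFinite _
  rw [← Nat.card_congr (Equiv.sigmaFiberEquiv (fun d : D => Quotient.mk (orbitSetoid f) d)),
    Nat.card_sigma]
  have : ∀ q : Quotient (orbitSetoid f), Nat.card {x // Quotient.mk (orbitSetoid f) x = q} = 3 := by
    intro q
    induction q using Quotient.ind with
    | _ d =>
      rw [← h d]
      refine Nat.card_congr (Equiv.subtypeEquivRight fun x => ?_)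
      constructor
      · intro hx; exact (Quotient.exact hx : f.SameCycle x d).symm
      · intro hx; exact Quotient.sound (show f.SameCycle x d from hx.symm)
  rw [Finset.sum_congr rfl (fun q _ => this q)]
  simp [mul_comm]

theorem card_dart [Finite V] (G : SimpleGraph V) : Nat.card G.Dart = 2 * Nat.card G.edgeSet := by
  classical
  letI := Fintype.ofFinite V
  rw [Nat.card_eq_fintype_card, SimpleGraph.dart_card_eq_twice_card_edges,
    Nat.card_eq_fintype_card, SimpleGraph.edgeFinset_card]

variable {G : SimpleGraph V} {σ : Equiv.Perm G.Dart}

theorem tml_of [Fintype V] (hT : IsPlaneTriangulation G σ) :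
    TML Set.univ (SimpleGraph.Dart.symm : G.Dart → G.Dart) (facePerm σ) (fun d => d.toProd.1) where
  aL := fun _ _ => trivial
  pL := fun _ _ => trivial
  inv := fun d _ => d.symm_symm
  cube := fun d _ => face_cube hT.face_size_eq d
  labp := fun d _ => by simp only [facePerm_apply, hT.rot.fst_eq]
  ne := fun d _ => by
    show d.toProd.1 ≠ d.toProd.2
    exact d.adj.ne
  orb := by
    intro P hP d _ e _ hde hPd
    haveI := finite_dart G
    obtain ⟨k, hk⟩ := (hT.rot.orbit_eq d e hde).exists_nat_pow_eq
    have : ∀ k : ℕ, P ((σ ^ k) d) := by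
      intro k
      induction k with
      | zero => simpa using hPd
      | succ k ih =>
        rw [pow_succ', Equiv.Perm.mul_apply]
        have := hP _ trivial ih
        rwa [facePerm_apply, SimpleGraph.Dart.symm_symm] at this
    rw [← hk]; exact this k
  euler := by
    haveI := finite_dart G
    have h1 := card_three (facePerm σ) hT.face_size_eq
    have h2 := card_dart G
    have h3 := hT.euler
    have h4 := hT.four_le_card
    have h5 : ((fun d : G.Dart => d.toProd.1) '' Set.univ) = Set.univ := by
      rw [Set.image_univ, Set.range_eq_univ]
      intro x
      haveI : Nontrivial V := Fintype.one_lt_card_iff_nontrivial.1 (by omega)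
      obtain ⟨y, hy⟩ := hT.connected.preconnected.exists_adj_of_nontrivial x
      exact ⟨⟨(x, y), hy⟩, rfl⟩
    rw [h5, Set.ncard_univ, Set.ncard_univ, Nat.card_eq_fintype_card (α := V)]
    rw [numFaces] at h3
    omega
  conn := by
    intro P hP d _ e _ hd
    exact walk_prop hT.connected P (fun x y hxy hx => hP ⟨(x, y), hxy⟩ trivial hx) _ _ hd

/-- A contraction of the triangulation `(G, σ)` along the vertex map `m`. -/
def Inv (G : SimpleGraph V) (σ : Equiv.Perm G.Dart) (m : V → V) : Prop :=
  ∃ (L : Set G.Dart) (α : G.Dart → G.Dart), TML L α (facePerm σ) (fun d => m d.toProd.1) ∧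
    (∀ d ∈ L, m (α d).toProd.1 = m d.toProd.2) ∧
    (∀ x y, G.Adj x y → m x ≠ m y → ∃ d ∈ L, m d.toProd.1 = m x ∧ m (α d).toProd.1 = m y)

theorem Inv.id [Fintype V] (hT : IsPlaneTriangulation G σ) : Inv G σ (fun x => x) :=
  ⟨_, _, tml_of hT, fun _ _ => rfl, fun x y h _ => ⟨⟨(x, y), h⟩, trivial, rfl, rfl⟩⟩

theorem Inv.step [Finite V] {m : V → V} (hI : Inv G σ m) {a y q : V}
    (hya : y ≠ a) (my : ∀ t, m t = y ↔ t = y) (mq : m q = a) (hqy : G.Adj q y)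
    (huq : ∀ t, m t = a → G.Adj t y → t = q)
    (hx : ∃ b1 b2 c1 c2, m b1 = a ∧ m b2 = a ∧ G.Adj b1 c1 ∧ G.Adj b2 c2 ∧ c1 ≠ y ∧ c2 ≠ y ∧
      m c1 ≠ a ∧ m c2 ≠ a ∧ m c1 ≠ m c2)
    (hy : ∃ c1 c2, G.Adj y c1 ∧ G.Adj y c2 ∧ m c1 ≠ a ∧ m c2 ≠ a ∧ m c1 ≠ m c2) :
    Inv G σ (fun t => mer a y (m t)) := by
  obtain ⟨L, α, hL, h1, h2⟩ := hI
  haveI := finite_dart G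
  have myy : m y = y := (my y).2 rfl
  obtain ⟨e, he, e1, e2⟩ := h2 q y hqy (by rw [mq, myy]; exact hya.symm)
  rw [mq] at e1
  rw [myy] at e2
  have huniq' : ∀ d ∈ L, m d.toProd.1 = a → m (α d).toProd.1 = y → d = ⟨(q, y), hqy⟩ := by
    intro d hd d1 d2
    have d3 : d.toProd.2 = y := by rw [← my, ← h1 d hd, d2]
    have d4 : d.toProd.1 = q := huq _ d1 (by rw [← d3]; exact d.adj)
    exact SimpleGraph.Dart.ext _ _ (Prod.ext d4 d3)
  have main := contract hL he (by
      intro d hd d1 d2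
      rw [huniq' e he e1 e2]
      exact huniq' d hd (by rw [← e1]; exact d1) (by rw [← e2]; exact d2))
    (by
      obtain ⟨b1, b2, c1, c2, k1, k2, k3, k4, k5, k6, k7, k8, k9⟩ := hx
      obtain ⟨d1, p1, p2, p3⟩ := h2 b1 c1 k3 (by rw [k1]; exact k7.symm)
      obtain ⟨d2, q1, q2, q3⟩ := h2 b2 c2 k4 (by rw [k2]; exact k8.symm)
      refine ⟨d1, p1, d2, q1, ?_, ?_, ?_, ?_, ?_⟩
      · simp only [p2, k1, e1]
      · simp only [q2, k2, e1]
      · simp only [p3, e2]; rw [Ne, my]; exact k5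
      · simp only [q3, e2]; rw [Ne, my]; exact k6
      · simp only [p3, q3]; exact k9)
    (by
      obtain ⟨c1, c2, k1, k2, k3, k4, k5⟩ := hy
      obtain ⟨d1, p1, p2, p3⟩ := h2 y c1 k1 (by
        rw [myy]; intro hh; exact k1.ne ((my c1).1 hh.symm).symm)
      obtain ⟨d2, q1, q2, q3⟩ := h2 y c2 k2 (by
        rw [myy]; intro hh; exact k2.ne ((my c2).1 hh.symm).symm)
      refine ⟨d1, p1, d2, q1, ?_, ?_, ?_, ?_, ?_⟩
      · simp only [p2, e2, myy]
      · simp only [q2, e2, myy]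
      · simp only [p3, e1]; exact k3
      · simp only [q3, e1]; exact k4
      · simp only [p3, q3]; exact k5)
  simp only [e1, e2] at main
  obtain ⟨L', α', hs, ht, g1, g2⟩ := main
  refine ⟨L', α', ht, ?_, ?_⟩
  · intro d hd
    show mer a y (m _) = mer a y (m _)
    rw [g1 d hd, h1 d (hs hd)]
  · intro x z hxz hne
    have hne' : m x ≠ m z := fun hh => hne (by simp only [hh])
    obtain ⟨d, hd, d1, d2⟩ := h2 x z hxz hne'
    obtain ⟨d', hd', d3, d4⟩ := g2 d hd (by rw [d1, d2]; exact hne)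
    exact ⟨d', hd', by rw [d1] at d3; exact d3, by rw [d2] at d4; exact d4⟩
end RS

namespace RS

theorem transfer {D W : Type} [Finite D] [Fintype W] {α φ : D → D} {lab : D → W}
    (h : TML Set.univ α φ lab) (hs : Function.Surjective lab)
    (hsim : ∀ d d', lab d = lab d' → lab (α d) = lab (α d') → d = d')
    (h4 : 4 ≤ Fintype.card W) :
    ∃ (T : SimpleGraph W) (σ : Equiv.Perm T.Dart), IsPlaneTriangulation T σ ∧
      ∀ d, T.Adj (lab d) (lab (α d)) := by
  classical
  obtain ⟨-, -, inv, cube, labp, ne, orb, euler, conn⟩ := h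
  simp only [Set.mem_univ, forall_const, Set.image_univ, Set.ncard_univ] at inv cube labp ne orb euler conn
  let T : SimpleGraph W :=
    { Adj := fun x y => ∃ d, lab d = x ∧ lab (α d) = y
      symm := ⟨by
        rintro x y ⟨d, h1, h2⟩
        exact ⟨α d, h2, by rw [inv, h1]⟩⟩
      loopless := ⟨by
        rintro x ⟨d, h1, h2⟩
        exact ne d (h1.trans h2.symm)⟩ }
  let E0 : D → T.Dart := fun d => ⟨(lab d, lab (α d)), ⟨d, rfl, rfl⟩⟩
  have hE0 : Function.Bijective E0 := by
    constructor
    · intro d d' hdd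
      have h1 : (E0 d).toProd = (E0 d').toProd := by rw [hdd]
      exact hsim d d' (congrArg Prod.fst h1) (congrArg Prod.snd h1)
    · rintro ⟨⟨x, y⟩, ⟨d, h1, h2⟩⟩
      exact ⟨d, SimpleGraph.Dart.ext _ _ (Prod.ext h1 h2)⟩
  let E : D ≃ T.Dart := Equiv.ofBijective E0 hE0
  let pα : Equiv.Perm D := ⟨α, α, inv, inv⟩
  let pφ : Equiv.Perm D := ⟨φ, fun d => φ (φ d), cube, cube⟩
  let σ : Equiv.Perm T.Dart := E.symm.trans ((pα.trans pφ).trans E)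
  have hσ : ∀ d, σ (E d) = E (φ (α d)) := by
    intro d
    show E (φ (α (E.symm (E d)))) = _
    rw [Equiv.symm_apply_apply]
  have hsymm : ∀ d, (E d).symm = E (α d) := by
    intro d
    apply SimpleGraph.Dart.ext
    apply Prod.ext
    · rfl
    · show lab d = lab (α (α d))
      rw [inv]
  have hface : ∀ d, facePerm σ (E d) = E (φ d) := by
    intro d
    rw [facePerm_apply, hsymm, hσ, inv]
  haveI : Finite T.Dart := finite_dart T
  have hne : ∀ d, φ d ≠ d := by
    intro d hd
    apply ne d
    rw [← labp d, hd]
  have hsize : ∀ d, faceSize σ d = 3 := by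
    intro d
    obtain ⟨d, rfl⟩ := E.surjective d
    rw [faceSize, card_sameCycle]
    haveI : Fact (Nat.Prime 3) := ⟨Nat.prime_three⟩
    apply Function.minimalPeriod_eq_prime
    · show facePerm σ (facePerm σ (facePerm σ (E d))) = E d
      rw [hface, hface, hface, cube]
    · intro hh
      have hh : facePerm σ (E d) = E d := hh
      rw [hface] at hh
      exact hne d (E.injective hh)
  obtain ⟨w0⟩ : Nonempty W := Fintype.card_pos_iff.1 (by omega)
  refine ⟨T, σ, ⟨?_, h4, ⟨?_, ?_⟩, ?_, hsize⟩, fun d => ⟨d, rfl, rfl⟩⟩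
  · haveI : Nonempty W := ⟨w0⟩
    refine ⟨fun x y => ?_⟩
    obtain ⟨d, rfl⟩ := hs x
    obtain ⟨d', rfl⟩ := hs y
    refine conn (fun t => T.Reachable (lab d) t) ?_ d d' (SimpleGraph.Reachable.refl _)
    intro e he
    exact he.trans (SimpleGraph.Adj.reachable (show T.Adj (lab e) (lab (α e)) from ⟨e, rfl, rfl⟩))
  · intro d
    obtain ⟨d, rfl⟩ := E.surjective d
    rw [hσ]
    show lab (φ (α d)) = lab d
    rw [labp, inv]
  · intro d e hde
    obtain ⟨d, rfl⟩ := E.surjective d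
    obtain ⟨e, rfl⟩ := E.surjective e
    refine orb (fun x => σ.SameCycle (E d) (E x)) ?_ d e hde (Equiv.Perm.SameCycle.refl _ _)
    intro x hx
    have h1 : σ.SameCycle (E d) (σ (E x)) := Equiv.Perm.sameCycle_apply_right.2 hx
    rwa [hσ] at h1
  · have h1 := card_three (facePerm σ) hsize
    have h2 := card_dart T
    have h3 : Nat.card T.Dart = Nat.card D := Nat.card_congr E.symm
    rw [hs.range_eq, Set.ncard_univ, Nat.card_eq_fintype_card (α := W)] at euler
    rw [numFaces]
    omega

/-- Darts of the simplified map. -/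
inductive GD (D : Type) : Type
  | a (d : D) : GD D
  | a' (d : D) : GD D
  | b (d : D) : GD D
  | b' (d : D) : GD D
  | c (d : D) : GD D
  | c' (d : D) : GD D
  | e (d : D) : GD D

/-- counting equivalence -/
def gdEquiv (D : Type) : (Fin 7 × D) ≃ GD D where
  toFun x := match x with
    | (0, d) => .a d
    | (1, d) => .a' d
    | (2, d) => .b d
    | (3, d) => .b' d
    | (4, d) => .c d
    | (5, d) => .c' d
    | (6, d) => .e d
  invFun x := match x with
    | .a d => (0, d)
    | .a' d => (1, d)
    | .b d => (2, d)
    | .b' d => (3, d)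
    | .c d => (4, d)
    | .c' d => (5, d)
    | .e d => (6, d)
  left_inv x := by
    obtain ⟨i, d⟩ := x
    fin_cases i <;> rfl
  right_inv x := by cases x <;> rfl

/-- edge involution of the simplified map -/
def gα {D : Type} (α : D → D) : GD D → GD D
  | .a d => .a' d
  | .a' d => .a d
  | .b d => .b' d
  | .b' d => .b d
  | .c d => .c' d
  | .c' d => .c d
  | .e d => .e (α d)

open Classical in
/-- face permutation of the simplified map -/
noncomputable def gφ {D : Type} (K : D → Prop) (α φ : D → D) : GD D → GD D
  | .a d => .c' (φ (φ d))
  | .a' d => if K d then .e d else .b (α d)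
  | .b d => if K d then .a' d else .e d
  | .b' d => .a (φ d)
  | .c d => .c (φ d)
  | .c' d => .b' d
  | .e d => if K d then .b d else .a' (α d)

open Classical in
/-- labels of the simplified map -/
noncomputable def glab {D W : Type} (K : D → Prop) (α φ : D → D) (lab : D → W) : GD D → W ⊕ D
  | .a d => .inl (lab d)
  | .a' d => .inr d
  | .b d => .inl (lab (α d))
  | .b' d => .inr d
  | .c d => .inr d
  | .c' d => .inr (φ d)
  | .e d => if K d then .inl (lab d) else .inr d

theorem exists_K {D W : Type} {α φ : D → D} {lab : D → W} (h : TML Set.univ α φ lab) :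
    ∃ K : D → Prop, (∀ d, K (α d) ↔ K d) ∧
      (∀ d d', K d → K d' → lab d = lab d' → lab (α d) = lab (α d') → d = d') ∧
      ∀ d, ∃ d', K d' ∧ lab d' = lab d ∧ lab (α d') = lab (α d) := by
  classical
  by_cases hD : Nonempty D
  swap
  · rw [not_nonempty_iff] at hD
    exact ⟨fun _ => True, fun d => hD.elim d, fun d => hD.elim d, fun d => hD.elim d⟩
  have inv : ∀ d, α (α d) = d := fun d => h.inv d trivial
  have ne : ∀ d, lab d ≠ lab (α d) := fun d => h.ne d trivial
  let f : D → Sym2 W := fun d => s(lab d, lab (α d))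
  have fα : ∀ d, f (α d) = f d := by
    intro d
    simp only [f, inv]
    exact Sym2.eq_swap
  let r : Sym2 W → D := Function.invFun f
  have hr : ∀ d, f (r (f d)) = f d := fun d => Function.invFun_eq ⟨d, rfl⟩
  refine ⟨fun d => d = r (f d) ∨ α d = r (f d), ?_, ?_, ?_⟩
  · intro d
    simp only [fα, inv]
    tauto
  · intro d d' h1 h2 h3 h4
    have h5 : f d = f d' := by simp only [f, h3, h4]
    rw [← h5] at h2
    rcases h1 with h1 | h1 <;> rcases h2 with h2 | h2
    · rw [h1, h2]
    · exfalso; apply ne d; rw [h4, h2, ← h1]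
    · exfalso; apply ne d; rw [h3, h2, ← h1]
    · rw [← inv d, h1, ← h2, inv]
  · intro d
    have h1 := hr d
    rcases Sym2.eq_iff.1 h1 with ⟨h2, h3⟩ | ⟨h2, h3⟩
    · exact ⟨r (f d), Or.inl (by rw [hr]), h2, h3⟩
    · exact ⟨α (r (f d)), Or.inr (by rw [fα, hr, inv]), h3, by rw [inv, h2]⟩

theorem gadget_simple {D W : Type} {α φ : D → D} {lab : D → W} (ne : ∀ d, lab d ≠ lab (α d))
    (npa : ∀ d, φ d ≠ α d) (np2 : ∀ d, φ (φ d) ≠ d) (inv : ∀ d, α (α d) = d)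
    (K : D → Prop) (hKα : ∀ d, K (α d) ↔ K d)
    (hKs : ∀ d d', K d → K d' → lab d = lab d' → lab (α d) = lab (α d') → d = d')
    (x y : GD D) (h1 : glab K α φ lab x = glab K α φ lab y)
    (h2 : glab K α φ lab (gα α x) = glab K α φ lab (gα α y)) : x = y := by
  rcases x with d | d | d | d | d | d | d <;> rcases y with d' | d' | d' | d' | d' | d' | d' <;>
    simp only [gα, glab, hKα] at h1 h2 <;> (try split_ifs at h1 h2) <;>
    (try simp only [Sum.inl.injEq, Sum.inr.injEq, reduceCtorEq] at h1) <;>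
    (try simp only [Sum.inl.injEq, Sum.inr.injEq, reduceCtorEq] at h2)
  all_goals first
    | (rw [h1]; done)
    | (rw [h2]; done)
    | (exfalso; subst h2; exact ne _ h1)
    | (exfalso; subst h2; exact ne _ h1.symm)
    | (exfalso; subst h1; exact ne _ h2)
    | (exfalso; subst h1; exact ne _ h2.symm)
    | (exfalso; subst h1; exact np2 _ h2)
    | (exfalso; subst h1; exact np2 _ h2.symm)
    | (exfalso; subst h1; exact npa _ h2)
    | (exfalso; subst h1; exact npa _ h2.symm)
    | (exfalso; subst h2; exact npa _ h1)
    | (exfalso; subst h2; exact npa _ h1.symm)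
    | (rw [hKs d d' (by assumption) (by assumption) h1 h2])
    | (exfalso; exact npa d (by rw [h1, h2, inv]))
    | (exfalso; exact npa d' (by rw [← h1, ← h2, inv]))
    | (exfalso; subst h2; rename_i u1 u2; exact u2 ((hKα _).2 u1))
    | (exfalso; simp_all; done)

theorem gadget {D W : Type} [Finite D] [Finite W] [Nonempty D] {α φ : D → D} {lab : D → W}
    (h : TML Set.univ α φ lab) (hs : Function.Surjective lab)
    (K : D → Prop) (hKα : ∀ d, K (α d) ↔ K d)
    (hKs : ∀ d d', K d → K d' → lab d = lab d' → lab (α d) = lab (α d') → d = d') :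
    TML Set.univ (gα α) (gφ K α φ) (glab K α φ lab) ∧
    Function.Surjective (glab K α φ lab) ∧
    (∀ d d', glab K α φ lab d = glab K α φ lab d' →
      glab K α φ lab (gα α d) = glab K α φ lab (gα α d') → d = d') ∧
    4 ≤ Nat.card (W ⊕ D) := by
  classical
  obtain ⟨-, -, inv, cube, labp, ne, orb, euler, conn⟩ := h
  simp only [Set.mem_univ, forall_const, Set.image_univ, Set.ncard_univ] at inv cube labp ne orb euler conn
  rw [hs.range_eq, Set.ncard_univ] at euler
  have np : ∀ d, φ d ≠ d := by
    intro d hd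
    apply ne d
    rw [← labp d, hd]
  have npa : ∀ d, φ d ≠ α d := by
    intro d hd
    apply ne (φ (φ d))
    rw [← labp (φ (φ d)), cube, labp (φ d), hd, inv]
  have np2 : ∀ d, φ (φ d) ≠ d := by
    intro d hd
    have := cube d
    rw [hd] at this
    exact np d this
  have surj : Function.Surjective (glab K α φ lab) := by
    rintro (w | d)
    · obtain ⟨d, rfl⟩ := hs w
      exact ⟨.a d, rfl⟩
    · exact ⟨.a' d, rfl⟩
  have Dpos : 0 < Nat.card D := Nat.card_pos
  refine ⟨⟨fun _ _ => trivial, fun _ _ => trivial, ?_, ?_, ?_, ?_, ?_, ?_, ?_⟩, surj, ?_, ?_⟩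
  · rintro (d | d | d | d | d | d | d) - <;> simp [gα, inv]
  · rintro (d | d | d | d | d | d | d) -
    · simp [gφ, cube]
    · by_cases hK : K d <;> simp [gφ, hK, hKα, inv]
    · by_cases hK : K d <;> simp [gφ, hK, hKα, inv]
    · simp [gφ, cube]
    · simp [gφ, cube]
    · simp [gφ, cube]
    · by_cases hK : K d <;> simp [gφ, hK, hKα, inv]
  · rintro (d | d | d | d | d | d | d) -
    · simp [gφ, gα, glab, cube]
    · by_cases hK : K d <;> simp [gφ, gα, glab, hK, hKα, inv]
    · by_cases hK : K d <;> simp [gφ, gα, glab, hK, hKα, inv]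
    · simp [gφ, gα, glab, labp]
    · simp [gφ, gα, glab]
    · simp [gφ, gα, glab]
    · by_cases hK : K d <;> simp [gφ, gα, glab, hK, hKα, inv]
  · rintro (d | d | d | d | d | d | d) -
    · simp [gα, glab]
    · simp [gα, glab]
    · simp [gα, glab]
    · simp [gα, glab]
    · simpa [gα, glab] using (np d).symm
    · simpa [gα, glab] using np d
    · by_cases hK : K d
      · simpa [gα, glab, hK, hKα] using ne d
      · simp only [gα, glab, hK, hKα, if_false]
        intro hh
        exact ne d (congrArg lab (Sum.inr.inj hh))
  · intro P hP x _ y _ hxy hPx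
    have hP : ∀ d, P d → P (gφ K α φ (gα α d)) := fun d => hP d trivial
    -- steps at inr
    have s1 : ∀ d, P (.a' d) → P (.c' (φ (φ d))) := fun d hd => by simpa [gα, gφ] using hP _ hd
    have s2 : ∀ d, P (.c' d) → P (.c (φ d)) := fun d hd => by simpa [gα, gφ] using hP _ hd
    have s3 : ∀ d, P (.c d) → P (.b' d) := fun d hd => by simpa [gα, gφ] using hP _ hd
    have s4 : ∀ d, K d → P (.b' d) → P (.a' d) := fun d hK hd => by
      simpa [gα, gφ, hK] using hP _ hd
    have s5 : ∀ d, ¬ K d → P (.b' d) → P (.e d) := fun d hK hd => by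
      simpa [gα, gφ, hK] using hP _ hd
    have s6 : ∀ d, ¬ K d → P (.e d) → P (.a' d) := fun d hK hd => by
      simpa [gα, gφ, hK, hKα, inv] using hP _ hd
    have s7 : ∀ d, P (.b' d) → P (.a' d) := fun d hd => by
      by_cases hK : K d
      · exact s4 d hK hd
      · exact s6 d hK (s5 d hK hd)
    -- steps at inl
    have t1 : ∀ d, K d → P (.a d) → P (.e d) := fun d hK hd => by
      simpa [gα, gφ, hK] using hP _ hd
    have t2 : ∀ d, ¬ K d → P (.a d) → P (.b (α d)) := fun d hK hd => by
      simpa [gα, gφ, hK] using hP _ hd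
    have t3 : ∀ d, K d → P (.e d) → P (.b (α d)) := fun d hK hd => by
      simpa [gα, gφ, hK, hKα] using hP _ hd
    have t4 : ∀ d, P (.b d) → P (.a (φ d)) := fun d hd => by simpa [gα, gφ] using hP _ hd
    have t5 : ∀ d, P (.a d) → P (.b (α d)) := fun d hd => by
      by_cases hK : K d
      · exact t3 d hK (t1 d hK hd)
      · exact t2 d hK hd
    have up : ∀ w, (∃ d, lab d = w ∧ P (.a d)) → ∀ d, lab d = w → P (.a d) := by
      rintro w ⟨d, hd, hPd⟩ d' hd'
      exact orb (fun d => P (.a d)) (fun d hd => t4 _ (t5 _ hd)) d d' (hd.trans hd'.symm) hPd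
    have toR : ∀ d x, glab K α φ lab x = .inr d → P x → P (.a' d) := by
      rintro d (d' | d' | d' | d' | d' | d' | d') hx hPx
      · simp [glab] at hx
      · simp only [glab, Sum.inr.injEq] at hx; subst hx; exact hPx
      · simp [glab] at hx
      · simp only [glab, Sum.inr.injEq] at hx; subst hx; exact s7 _ hPx
      · simp only [glab, Sum.inr.injEq] at hx; subst hx; exact s7 _ (s3 _ hPx)
      · simp only [glab, Sum.inr.injEq] at hx; subst hx; exact s7 _ (s3 _ (s2 _ hPx))
      · by_cases hK : K d'
        · simp [glab, hK] at hx
        · simp only [glab, hK, if_false, Sum.inr.injEq] at hx; subst hx; exact s6 _ hK hPx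
    have ofR : ∀ d x, glab K α φ lab x = .inr d → P (.a' d) → P x := by
      rintro d x hx hPd
      have g1 := s1 d hPd
      have g2 := s2 _ g1
      rw [cube] at g2
      have g3 := s3 _ g2
      rcases x with d' | d' | d' | d' | d' | d' | d'
      · simp [glab] at hx
      · simp only [glab, Sum.inr.injEq] at hx; subst hx; exact hPd
      · simp [glab] at hx
      · simp only [glab, Sum.inr.injEq] at hx; subst hx; exact g3
      · simp only [glab, Sum.inr.injEq] at hx; subst hx; exact g2
      · simp only [glab, Sum.inr.injEq] at hx; subst hx
        rw [cube] at g1; exact g1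
      · by_cases hK : K d'
        · simp [glab, hK] at hx
        · simp only [glab, hK, if_false, Sum.inr.injEq] at hx; subst hx; exact s5 _ hK g3
    have toL : ∀ w x, glab K α φ lab x = .inl w → P x → ∃ d, lab d = w ∧ P (.a d) := by
      rintro w (d' | d' | d' | d' | d' | d' | d') hx hPx
      · simp only [glab, Sum.inl.injEq] at hx; exact ⟨d', hx, hPx⟩
      · simp [glab] at hx
      · simp only [glab, Sum.inl.injEq] at hx; exact ⟨φ d', by rw [labp, hx], t4 _ hPx⟩
      · simp [glab] at hx
      · simp [glab] at hx
      · simp [glab] at hx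
      · by_cases hK : K d'
        · simp only [glab, hK, if_true, Sum.inl.injEq] at hx
          exact ⟨φ (α d'), by rw [labp, inv, hx], t4 _ (t3 _ hK hPx)⟩
        · simp [glab, hK] at hx
    have ofL : ∀ w x, glab K α φ lab x = .inl w → (∃ d, lab d = w ∧ P (.a d)) → P x := by
      rintro w (d' | d' | d' | d' | d' | d' | d') hx hPx
      · simp only [glab, Sum.inl.injEq] at hx; exact up w hPx _ hx
      · simp [glab] at hx
      · simp only [glab, Sum.inl.injEq] at hx
        have := t5 _ (up w hPx _ hx)
        rwa [inv] at this
      · simp [glab] at hx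
      · simp [glab] at hx
      · simp [glab] at hx
      · by_cases hK : K d'
        · simp only [glab, hK, if_true, Sum.inl.injEq] at hx
          exact t1 _ hK (up w hPx _ hx)
        · simp [glab, hK] at hx
    rcases hl : glab K α φ lab x with w | d
    · exact ofL w y (by rw [← hxy, hl]) (toL w x hl hPx)
    · exact ofR d y (by rw [← hxy, hl]) (toR d x hl hPx)
  · rw [Set.image_univ, surj.range_eq, Set.ncard_univ, Set.ncard_univ,
      ← Nat.card_congr (gdEquiv D), Nat.card_prod, Nat.card_sum, Nat.card_fin]
    omega
  · intro P hP x _ y _ hPx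
    have hP : ∀ d, P (glab K α φ lab d) → P (glab K α φ lab (gα α d)) := fun d => hP d trivial
    have r1 : ∀ d, P (.inr d) → P (.inl (lab d)) := fun d hd => hP (.a' d) hd
    have r2 : ∀ d, P (.inl (lab d)) → P (.inr d) := fun d hd => hP (.a d) hd
    have r3 : ∀ d, P (.inr d) → P (.inl (lab (α d))) := fun d hd => hP (.b' d) hd
    have key : ∀ t : W ⊕ D, P t → ∃ d, P (.inl (lab d)) := by
      rintro (w | d) ht
      · obtain ⟨d, rfl⟩ := hs w
        exact ⟨d, ht⟩
      · exact ⟨d, r1 d ht⟩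
    obtain ⟨d0, h0⟩ := key _ hPx
    have all : ∀ d, P (.inl (lab d)) := fun d =>
      conn (fun w => P (.inl w)) (fun d hd => r3 d (r2 d hd)) d0 d h0
    have all' : ∀ t : W ⊕ D, P t := by
      rintro (w | d)
      · obtain ⟨d, rfl⟩ := hs w
        exact all d
      · exact r2 d (all d)
    exact all' _
  · intro x y h1 h2
    exact gadget_simple ne npa np2 inv K hKα hKs x y h1 h2
  · rw [Nat.card_sum]
    omega
end RS

namespace RS

theorem TML.restrict {D W : Type} [Finite D] {L : Set D} {α φ : D → D} {lab : D → W}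
    (h : TML L α φ lab) :
    TML Set.univ (fun d : L => (⟨α d.1, h.aL d.1 d.2⟩ : L))
      (fun d : L => (⟨φ d.1, h.pL d.1 d.2⟩ : L))
      (fun d : L => (⟨lab d.1, d.1, d.2, rfl⟩ : (lab '' L : Set W))) where
  aL := fun _ _ => trivial
  pL := fun _ _ => trivial
  inv := fun d _ => Subtype.ext (h.inv d.1 d.2)
  cube := fun d _ => Subtype.ext (h.cube d.1 d.2)
  labp := fun d _ => Subtype.ext (h.labp d.1 d.2)
  ne := fun d _ hh => h.ne d.1 d.2 (congrArg Subtype.val hh)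
  orb := by
    intro P hP d _ e _ hde hPd
    have := h.orb (fun x => ∃ hx : x ∈ L, P ⟨x, hx⟩)
      (fun x _ hx => ⟨_, hP ⟨x, hx.1⟩ trivial hx.2⟩) d.1 d.2 e.1 e.2
      (congrArg Subtype.val hde) ⟨d.2, hPd⟩
    exact this.2
  euler := by
    have h1 := h.euler
    have h2 : ((fun d : L => (⟨lab d.1, d.1, d.2, rfl⟩ : (lab '' L : Set W))) '' Set.univ) =
        Set.univ := by
      rw [Set.image_univ, Set.range_eq_univ]
      rintro ⟨_, d, hd, rfl⟩
      exact ⟨⟨d, hd⟩, rfl⟩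
    rw [h2, Set.ncard_univ, Set.ncard_univ, Nat.card_coe_set_eq, Nat.card_coe_set_eq]
    exact h1
  conn := by
    intro P hP d _ e _ hPd
    have := h.conn (fun x => ∃ hx : x ∈ lab '' L, P ⟨x, hx⟩)
      (fun x hx hPx => ⟨⟨_, h.aL x hx, rfl⟩, hP ⟨x, hx⟩ trivial hPx.2⟩) d.1 d.2 e.1 e.2
      ⟨⟨d.1, d.2, rfl⟩, hPd⟩
    exact this.2

theorem planar_of_tml {D W W0 : Type} [Finite D] [Fintype W0] {L : Set D} {α φ : D → D}
    {lab : D → W} (h : TML L α φ lab) (H : SimpleGraph W0) (f : W0 → W)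
    (hf : Function.Injective f) (hfL : ∀ w, f w ∈ lab '' L)
    (hH : ∀ x y, H.Adj x y → ∃ d ∈ L, lab d = f x ∧ lab (α d) = f y) : IsPlanar H := by
  classical
  have hr := h.restrict
  haveI : Finite (lab '' L : Set W) := Set.Finite.image lab (Set.toFinite L)
  haveI : Nonempty L := by
    by_contra hc
    rw [not_nonempty_iff, Set.isEmpty_coe_sort] at hc
    have := h.euler
    rw [hc] at this
    simp at this
  have hs : Function.Surjective (fun d : L => (⟨lab d.1, d.1, d.2, rfl⟩ : (lab '' L : Set W))) := by
    rintro ⟨_, d, hd, rfl⟩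
    exact ⟨⟨d, hd⟩, rfl⟩
  obtain ⟨K, k1, k2, k3⟩ := exists_K hr
  obtain ⟨g1, g2, g3, g4⟩ := gadget hr hs K k1 k2
  letI : Fintype ((lab '' L : Set W) ⊕ L) := Fintype.ofFinite _
  haveI : Finite (GD L) := Finite.of_equiv _ (gdEquiv L)
  obtain ⟨T, σ, hT, hadj⟩ := transfer g1 g2 g3 (by rw [← Nat.card_eq_fintype_card]; exact g4)
  refine ⟨_, _, T, σ, hT, ⟨fun x => Sum.inl ⟨f x, hfL x⟩, ?_⟩, ?_⟩
  · intro x y hxy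
    obtain ⟨d, hd, d1, d2⟩ := hH x y hxy
    obtain ⟨d', hK, e1, e2⟩ := k3 ⟨d, hd⟩
    have := hadj (.e d')
    have hK' := (k1 d').2 hK
    simp only [gα, glab, hK, hK', if_true] at this
    have e1' : lab d'.1 = f x := by rw [← d1]; exact congrArg Subtype.val e1
    have e2' : lab (α d'.1) = f y := by rw [← d2]; exact congrArg Subtype.val e2
    convert this using 3
    · exact Subtype.ext e1'.symm
    · exact Subtype.ext e2'.symm
  · intro x y hxy
    exact hf (congrArg Subtype.val (Sum.inl.inj hxy))
end RS

namespace RS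
variable {G : SimpleGraph V} {σ : Equiv.Perm G.Dart}

theorem two_nbrs [Fintype V] {z : V} (B : List V) (h : B.length + 2 ≤ deg G z) :
    ∃ c1 c2, G.Adj z c1 ∧ G.Adj z c2 ∧ c1 ∉ B ∧ c2 ∉ B ∧ c1 ≠ c2 := by
  classical
  have h1 : (G.neighborFinset z).card = deg G z := by
    rw [deg, Nat.card_eq_fintype_card, SimpleGraph.card_neighborFinset_eq_degree,
      SimpleGraph.card_neighborSet_eq_degree]
  have h2 := Finset.le_card_sdiff B.toFinset (G.neighborFinset z)
  have h3 := List.toFinset_card_le B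
  obtain ⟨c1, m1, c2, m2, hne⟩ := Finset.one_lt_card.1
    (show 1 < (G.neighborFinset z \ B.toFinset).card by omega)
  simp only [Finset.mem_sdiff, SimpleGraph.mem_neighborFinset, List.mem_toFinset] at m1 m2
  exact ⟨c1, c2, m1.1, m2.1, m1.2, m2.2, hne⟩

open Classical in
/-- collapse the members of `X` to `a` -/
noncomputable def mm (a : V) (X : List V) (t : V) : V := if t ∈ X then a else t

theorem Inv.step' [Fintype V] (hd : ∀ z, 5 ≤ deg G z) {a : V} {X : List V}
    (hI : Inv G σ (mm a X)) (ha : a ∈ X) (hX : X.length ≤ 3) {y q : V} (hq : q ∈ X) (hy : y ∉ X)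
    (hqy : G.Adj q y) (hu : ∀ t ∈ X, G.Adj t y → t = q) : Inv G σ (mm a (y :: X)) := by
  classical
  have min : ∀ t, t ∈ X → mm a X t = a := fun t ht => by simp [mm, ht]
  have mout : ∀ t, t ∉ X → mm a X t = t := fun t ht => by simp [mm, ht]
  have hya : y ≠ a := fun h => hy (h ▸ ha)
  have mne : ∀ t, t ∉ X → mm a X t ≠ a := fun t ht h => by
    rw [mout t ht] at h; exact ht (h ▸ ha)
  have meq : ∀ t, mm a X t = a → t ∈ X := fun t ht => by
    by_contra hh; exact mne t hh ht
  have key := Inv.step hI (a := a) (y := y) (q := q) hya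
    (by
      intro t
      by_cases ht : t ∈ X
      · rw [min t ht]
        exact ⟨fun h => absurd h.symm hya, fun h => absurd (h ▸ ht) hy⟩
      · rw [mout t ht])
    (min q hq) hqy (fun t ht hty => hu t (meq t ht) hty)
    (by
      have hl : (X.erase q).length + 1 = X.length := by
        rw [List.length_erase_of_mem hq]
        have := List.length_pos_of_mem hq
        omega
      obtain ⟨c1, c2, k1, k2, k3, k4, k5⟩ := two_nbrs (G := G) (z := q) (y :: X.erase q) (by
        have := hd q
        simp only [List.length_cons]; omega)
      simp only [List.mem_cons, not_or] at k3 k4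
      have n1 : c1 ∉ X := fun h => k3.2 ((List.mem_erase_of_ne k1.ne').2 h)
      have n2 : c2 ∉ X := fun h => k4.2 ((List.mem_erase_of_ne k2.ne').2 h)
      exact ⟨q, q, c1, c2, min q hq, min q hq, k1, k2, k3.1, k4.1, mne _ n1, mne _ n2, by
        rw [mout _ n1, mout _ n2]; exact k5⟩)
    (by
      obtain ⟨c1, c2, k1, k2, k3, k4, k5⟩ := two_nbrs (G := G) (z := y) [q] (by
        have := hd y
        simp only [List.length_cons, List.length_nil]; omega)
      simp only [List.mem_cons, List.not_mem_nil, or_false] at k3 k4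
      have n1 : c1 ∉ X := fun h => k3 (hu c1 h k1.symm)
      have n2 : c2 ∉ X := fun h => k4 (hu c2 h k2.symm)
      exact ⟨c1, c2, k1, k2, mne _ n1, mne _ n2, by rw [mout _ n1, mout _ n2]; exact k5⟩)
  have : (fun t => mer a y (mm a X t)) = mm a (y :: X) := by
    funext t
    by_cases ht : t ∈ X
    · rw [min t ht]; simp [mer, mm, ht]
    · rw [mout t ht]; simp [mer, mm, ht]
  rwa [this] at key

theorem inv_path2 [Fintype V] (hT : IsPlaneTriangulation G σ) (hd : ∀ z, 5 ≤ deg G z) {a p : V}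
    (hap : G.Adj a p) : Inv G σ (mm a [p, a]) := by
  classical
  have h0 : Inv G σ (mm a [a]) := by
    have := Inv.id hT
    have h : (fun x => x) = mm a [a] := by
      funext x
      by_cases hx : x = a <;> simp [mm, hx]
    rwa [h] at this
  exact h0.step' hd (by simp) (by simp) (q := a) (by simp) (by simpa using hap.ne') hap (by simp)

theorem ident_of_inv [Fintype V] (hG : IsMinimalCounterexample G σ) {S : List V} (hS : S.Nodup)
    (hS5 : S.length = 5) {a b : V} {X : List V} (hI : Inv G σ (mm a X)) (haS : a ∉ S) (hbS : b ∉ S)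
    (hab : a ≠ b) (hnab : ¬ G.Adj a b) (ha : a ∈ X) (hb : b ∈ X)
    (hX : ∀ t ∈ X, t = a ∨ t = b ∨ t ∈ S) (hXl : X.length ≤ 4) :
    ∃ R : Set V, St G S R ∧ (a ∈ R ↔ b ∈ R) ∧ (a ∉ R → 6 * R.ncard + 6 ≤ Fintype.card V) ∧
      6 * R.ncard ≤ Fintype.card V := by
  classical
  have hd := five_le_deg hG
  have min : ∀ t, t ∈ X → mm a X t = a := fun t ht => by simp [mm, ht]
  have mout : ∀ t, t ∉ X → mm a X t = t := fun t ht => by simp [mm, ht]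
  obtain ⟨m, hm⟩ : ∃ m, m = mm a X := ⟨_, rfl⟩
  rw [← hm] at hI min mout
  have mval : ∀ t, t ∉ S → t ≠ b → m t = t := by
    intro t ht htb
    by_cases htX : t ∈ X
    · rcases hX t htX with h | h | h
      · rw [min t htX, h]
      · exact absurd h htb
      · exact absurd h ht
    · exact mout t htX
  have mb : m b = a := min b hb
  obtain ⟨L, α, hL, h1, h2⟩ := hI
  let W0 := {x : V // x ∉ S ∧ x ≠ b}
  let H : SimpleGraph W0 :=
    { Adj := fun x y => ∃ d ∈ L, m d.toProd.1 = x.1 ∧ m (α d).toProd.1 = y.1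
      symm := ⟨by
        rintro x y ⟨d, hdL, e1, e2⟩
        exact ⟨α d, hL.aL d hdL, e2, by rw [hL.inv d hdL, e1]⟩⟩
      loopless := ⟨by
        rintro x ⟨d, hdL, e1, e2⟩
        exact hL.ne d hdL (e1.trans e2.symm)⟩ }
  haveI := finite_dart G
  have hpl : IsPlanar H := by
    refine planar_of_tml hL H Subtype.val Subtype.val_injective ?_ (fun x y h => h)
    rintro ⟨x, hxS, hxb⟩
    have hnb : ∃ t, G.Adj x t ∧ m x ≠ m t := by
      obtain ⟨c1, c2, k1, k2, k3, k4, k5⟩ := two_nbrs (G := G) (z := x) (X.erase a) (by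
        have := hd x
        rw [List.length_erase_of_mem ha]
        have := List.length_pos_of_mem ha
        omega)
      rw [mval x hxS hxb]
      by_cases hca : c1 = a
      · have hc2 : c2 ∉ X := fun h => k4 ((List.mem_erase_of_ne (by rw [← hca]; exact k5.symm)).2 h)
        exact ⟨c2, k2, by rw [mout c2 hc2]; exact k2.ne⟩
      · have hc1 : c1 ∉ X := fun h => k3 ((List.mem_erase_of_ne hca).2 h)
        exact ⟨c1, k1, by rw [mout c1 hc1]; exact k1.ne⟩
    obtain ⟨t, ht, hne⟩ := hnb
    obtain ⟨d, hdL, e1, _⟩ := h2 x t ht hne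
    exact ⟨d, hdL, by rw [mval x hxS hxb] at e1; exact e1⟩
  have hcS : (b :: S).Nodup := List.nodup_cons.2 ⟨hbS, hS⟩
  have hcard : Fintype.card W0 + 6 = Fintype.card V := by
    have e1 := card_notMem hcS
    have e2 : Fintype.card W0 = Fintype.card {x : V // x ∉ b :: S} :=
      Fintype.card_congr (Equiv.subtypeEquivRight (by intro x; simp [and_comm]))
    simp only [List.length_cons, hS5] at e1
    omega
  have mW : ∀ x : {x : V // x ∉ S}, m x.1 ∉ S ∧ m x.1 ≠ b := by
    rintro ⟨x, hx⟩
    by_cases hxb : x = b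
    · subst hxb; simp only [mb]; exact ⟨haS, hab⟩
    · simp only [mval x hx hxb]; exact ⟨hx, hxb⟩
  obtain ⟨R, r1, K, r2, r3⟩ := St.lift hG hS W0 H hpl (by omega) (fun x => ⟨m x.1, mW x⟩) (by
    rintro ⟨x, hx⟩ ⟨y, hy⟩ hxy
    have hne : m x ≠ m y := by
      intro hh
      by_cases hxb : x = b
      · by_cases hyb : y = b
        · exact hxy.ne (hxb.trans hyb.symm)
        · rw [hxb, mb, mval y hy hyb] at hh
          apply hnab
          rw [hh, ← hxb]; exact hxy.symm
      · by_cases hyb : y = b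
        · rw [hyb, mb, mval x hx hxb] at hh
          apply hnab
          rw [← hh, ← hyb]; exact hxy
        · rw [mval x hx hxb, mval y hy hyb] at hh
          exact hxy.ne hh
    exact h2 x y hxy hne)
  have haR : a ∈ R ↔ b ∈ R := by
    rw [r3 a haS, r3 b hbS]
    simp only [mb, mval a haS hab]
  have hsub : R ⊆ insert b (Subtype.val '' K) := by
    intro x hx
    have hxS : x ∉ S := fun h => r1.2.1 x h hx
    by_cases hxb : x = b
    · exact Or.inl hxb
    · right
      have := (r3 x hxS).1 hx
      exact ⟨_, this, mval x hxS hxb⟩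
  have hKc : (Subtype.val '' K).ncard = K.ncard := Set.ncard_image_of_injective _ Subtype.val_injective
  refine ⟨R, r1, haR, ?_, ?_⟩
  · intro haR'
    have hsub' : R ⊆ Subtype.val '' K := by
      intro x hx
      rcases hsub hx with h | h
      · exact absurd (haR.2 (h ▸ hx)) haR'
      · exact h
    have := Set.ncard_le_ncard hsub' (Set.toFinite _)
    omega
  · have e1 := Set.ncard_le_ncard hsub (Set.toFinite _)
    have e2 := Set.ncard_insert_le b (Subtype.val '' K)
    omega

/-- Identification along a path of length two through `S`. -/
theorem ident2 [Fintype V] (hG : IsMinimalCounterexample G σ) {S : List V} (hS : S.Nodup)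
    (hS5 : S.length = 5) {a b p : V} (haS : a ∉ S) (hbS : b ∉ S) (hpS : p ∈ S)
    (hab : a ≠ b) (hnab : ¬ G.Adj a b) (hap : G.Adj a p) (hpb : G.Adj p b) :
    ∃ R : Set V, St G S R ∧ (a ∈ R ↔ b ∈ R) ∧ (a ∉ R → 6 * R.ncard + 6 ≤ Fintype.card V) ∧
      6 * R.ncard ≤ Fintype.card V := by
  have hd := five_le_deg hG
  have h1 := (inv_path2 hG.1 hd hap).step' hd (y := b) (q := p) (by simp) (by simp) (by simp)
    (by simp [hab.symm, hpb.ne']) hpb (by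
      intro t ht htb
      simp only [List.mem_cons, List.not_mem_nil, or_false] at ht
      rcases ht with h | h
      · exact h
      · subst h; exact absurd htb hnab)
  refine ident_of_inv hG hS hS5 h1 haS hbS hab hnab (by simp) (by simp) ?_ (by simp)
  intro t ht
  simp only [List.mem_cons, List.not_mem_nil, or_false] at ht
  rcases ht with h | h | h
  · exact Or.inr (Or.inl h)
  · subst h; exact Or.inr (Or.inr hpS)
  · exact Or.inl h

/-- Identification along a path of length three through `S`. -/
theorem ident3 [Fintype V] (hG : IsMinimalCounterexample G σ) {S : List V} (hS : S.Nodup)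
    (hS5 : S.length = 5) {a b p q : V} (haS : a ∉ S) (hbS : b ∉ S) (hpS : p ∈ S) (hqS : q ∈ S)
    (hab : a ≠ b) (hnab : ¬ G.Adj a b) (hap : G.Adj a p) (hpq : G.Adj p q) (hqb : G.Adj q b)
    (hnaq : ¬ G.Adj a q) (hnpb : ¬ G.Adj p b) :
    ∃ R : Set V, St G S R ∧ (a ∈ R ↔ b ∈ R) ∧ (a ∉ R → 6 * R.ncard + 6 ≤ Fintype.card V) ∧
      6 * R.ncard ≤ Fintype.card V := by
  have hd := five_le_deg hG
  have hqa : q ≠ a := fun h => haS (h ▸ hqS)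
  have hbp : b ≠ p := fun h => hbS (h ▸ hpS)
  have h0 := (inv_path2 hG.1 hd hap).step' hd (y := q) (q := p) (by simp) (by simp) (by simp)
    (by simp [hqa, hpq.ne']) hpq (by
      intro t ht htb
      simp only [List.mem_cons, List.not_mem_nil, or_false] at ht
      rcases ht with h | h
      · exact h
      · subst h; exact absurd htb hnaq)
  have h1 := h0.step' hd (y := b) (q := q) (by simp) (by simp) (by simp)
    (by simp [hab.symm, hbp, hqb.ne']) hqb (by
      intro t ht htb
      simp only [List.mem_cons, List.not_mem_nil, or_false] at ht
      rcases ht with h | h | h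
      · exact h
      · subst h; exact absurd htb hnpb
      · subst h; exact absurd htb hnab)
  refine ident_of_inv hG hS hS5 h1 haS hbS hab hnab (by simp) (by simp) ?_ (by simp)
  intro t ht
  simp only [List.mem_cons, List.not_mem_nil, or_false] at ht
  rcases ht with h | h | h | h
  · exact Or.inr (Or.inl h)
  · subst h; exact Or.inr (Or.inr hqS)
  · subst h; exact Or.inr (Or.inr hpS)
  · exact Or.inl h
end RS

namespace RS
variable {G : SimpleGraph V} {σ : Equiv.Perm G.Dart}

/-- The local picture at a vertex of degree five. -/
theorem five_around [Fintype V] (hT : IsPlaneTriangulation G σ) {z a b c d e : V} (hz : deg G z = 5)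
    (h1 : NextNbr σ z a b) (h2 : NextNbr σ z b c) (h3 : NextNbr σ z c d) (h4 : NextNbr σ z d e) :
    NextNbr σ z e a ∧ [a, b, c, d, e].Nodup ∧ (∀ y, G.Adj z y → y ∈ [a, b, c, d, e]) ∧
    Cr G z a b c d ∧ Cr G z a b c e ∧ Cr G z a b d e ∧ Cr G z a c d e ∧ Cr G z b c d e := by
  have hr := hT.rot
  have ha := h1.1
  have e0 : ((σ ^ 0) ⟨(z, a), ha⟩).toProd.2 = a := by simp
  have e1 := next_pow hr ha 0 e0 h1
  have e2 := next_pow hr ha 1 e1 h2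
  have e3 := next_pow hr ha 2 e2 h3
  have e4 := next_pow hr ha 3 e3 h4
  obtain ⟨a', h5⟩ := exists_next hr (next_right hr h4)
  have hne : ∀ i j : ℕ, ∀ x y : V, i < 5 → j < 5 → i ≠ j → ((σ ^ i) ⟨(z, a), ha⟩).toProd.2 = x →
      ((σ ^ j) ⟨(z, a), ha⟩).toProd.2 = y → x ≠ y := by
    intro i j x y hi hj hij hx hy hxy
    exact hij (pow_snd_inj hr ha (by omega) (by omega) (by rw [hx, hy, hxy]))
  have hall : ∀ y, G.Adj z y → y ∈ [a, b, c, d, e] := by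
    intro y hy
    by_cases hay : a = y
    · simp [hay]
    obtain ⟨i, i0, i5, hi⟩ := exists_pos hr ha hy hay
    have hi' := congrArg (fun d : G.Dart => d.toProd.2) hi
    rw [hz] at i5
    simp only at hi'
    interval_cases i
    · rw [e1] at hi'; simp [hi']
    · rw [e2] at hi'; simp [hi']
    · rw [e3] at hi'; simp [hi']
    · rw [e4] at hi'; simp [hi']
  have hnd : [a, b, c, d, e].Nodup := by
    simp only [List.nodup_cons, List.mem_cons, List.not_mem_nil, or_false, not_or, not_false_eq_true,
      List.nodup_nil, and_true]
    exact ⟨⟨hne 0 1 _ _ (by omega) (by omega) (by omega) e0 e1, hne 0 2 _ _ (by omega) (by omega) (by omega) e0 e2,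
      hne 0 3 _ _ (by omega) (by omega) (by omega) e0 e3, hne 0 4 _ _ (by omega) (by omega) (by omega) e0 e4⟩,
      ⟨hne 1 2 _ _ (by omega) (by omega) (by omega) e1 e2, hne 1 3 _ _ (by omega) (by omega) (by omega) e1 e3,
      hne 1 4 _ _ (by omega) (by omega) (by omega) e1 e4⟩,
      ⟨hne 2 3 _ _ (by omega) (by omega) (by omega) e2 e3, hne 2 4 _ _ (by omega) (by omega) (by omega) e2 e4⟩,
      hne 3 4 _ _ (by omega) (by omega) (by omega) e3 e4⟩
  refine ⟨?_, hnd, hall, ?_, ?_, ?_, ?_, ?_⟩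
  · have hm := hall a' (next_right hr h5)
    simp only [List.nodup_cons, List.mem_cons, List.not_mem_nil, or_false, not_or] at hnd hm
    obtain ⟨⟨ab, ac, ad, ae⟩, ⟨bc, bd, be⟩, ⟨cd, ce⟩, de, -⟩ := hnd
    rcases hm with rfl | rfl | rfl | rfl | rfl
    · exact h5
    · exact absurd (next_inj hr h1 h5) ae
    · exact absurd (next_inj hr h2 h5) be
    · exact absurd (next_inj hr h3 h5) ce
    · exact absurd (next_inj hr h4 h5) de
  · exact cr_of_pos hT ha 1 2 3 (by omega) (by omega) (by omega) (by omega) e1 e2 e3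
  · exact cr_of_pos hT ha 1 2 4 (by omega) (by omega) (by omega) (by omega) e1 e2 e4
  · exact cr_of_pos hT ha 1 3 4 (by omega) (by omega) (by omega) (by omega) e1 e3 e4
  · exact cr_of_pos hT ha 2 3 4 (by omega) (by omega) (by omega) (by omega) e2 e3 e4
  · have f0 : ((σ ^ 0) ⟨(z, b), h2.1⟩).toProd.2 = b := by simp
    have f1 := next_pow hr h2.1 0 f0 h2
    have f2 := next_pow hr h2.1 1 f1 h3
    have f3 := next_pow hr h2.1 2 f2 h4
    exact cr_of_pos hT h2.1 1 2 3 (by omega) (by omega) (by omega) (by omega) f1 f2 f3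

theorem Cr.no_edge {z a b c d : V} (h : Cr G z a b c d) (za : z ≠ a) (zb : z ≠ b) (zc : z ≠ c)
    (zd : z ≠ d) (ab : a ≠ b) (ad : a ≠ d) (cb : c ≠ b) (cd : c ≠ d) (hbd : G.Adj b d) :
    ¬ G.Adj a c := by
  intro hac
  refine h (fun x => x = a ∨ x = c) (fun x => x = b ∨ x = d) ?_ ?_ ?_ (by simp) (by simp) (by simp)
    (by simp) (Relation.ReflTransGen.single ⟨hac, by simp, by simp⟩)
    (Relation.ReflTransGen.single ⟨hbd, by simp, by simp⟩)
  · rintro x (rfl | rfl) (rfl | rfl) <;> contradiction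
  · simp [za, zc]
  · simp [zb, zd]

theorem Cr.no_path {z a b c d m : V} (h : Cr G z a b c d) (za : z ≠ a) (zb : z ≠ b) (zc : z ≠ c)
    (zd : z ≠ d) (ab : a ≠ b) (ad : a ≠ d) (cb : c ≠ b) (cd : c ≠ d) (zm : z ≠ m) (mb : m ≠ b)
    (md : m ≠ d) (hbd : G.Adj b d) (ham : G.Adj a m) : ¬ G.Adj m c := by
  intro hmc
  refine h (fun x => x = a ∨ x = m ∨ x = c) (fun x => x = b ∨ x = d) ?_ ?_ ?_ (by simp) (by simp) (by simp)
    (by simp) ((Relation.ReflTransGen.single ⟨ham, by simp, by simp⟩).tail ⟨hmc, by simp, by simp⟩)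
    (Relation.ReflTransGen.single ⟨hbd, by simp, by simp⟩)
  · rintro x (rfl | rfl | rfl) (rfl | rfl) <;> contradiction
  · simp [za, zc, zm]
  · simp [zb, zd]

def Good (G : SimpleGraph V) [Fintype V] (S : List V) (v u w w' : V) : Prop :=
  ∃ (a : V) (R : Set V), (G.Adj u a ∨ G.Adj w a ∨ G.Adj w' a) ∧ St G S R ∧
    (a ∉ R → 6 * R.ncard + 6 ≤ Fintype.card V) ∧ 6 * R.ncard ≤ Fintype.card V

theorem pair1 [Fintype V] (hG : IsMinimalCounterexample G σ) {S : List V} (hS : S.Nodup)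
    (hS5 : S.length = 5) {v u w w' x n1 n2 s : V}
    (hmem : ∀ y, y ∈ S ↔ y = v ∨ y = u ∨ y = w ∨ y = w' ∨ y = x)
    (huw : G.Adj u w) (huw' : G.Adj u w') (hun1 : G.Adj u n1) (hun2 : G.Adj u n2) (huv : G.Adj u v)
    (hws : G.Adj w s) (hNu : ∀ y, G.Adj u y → y = w ∨ y = v ∨ y = w' ∨ y = n1 ∨ y = n2)
    (c1 : Cr G u w v n2 n1) (c2 : Cr G u w v w' n1) (hv1 : G.Adj v n1)
    (nwv : w ≠ v) (nww : w ≠ w') (nw1 : w ≠ n1) (nw2 : w ≠ n2) (nv2 : v ≠ n2) (nvw' : v ≠ w')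
    (nw'1 : w' ≠ n1) (nw'2 : w' ≠ n2) (n12 : n1 ≠ n2) (n2x : n2 ≠ x)
    (su : s ≠ u) (sv : s ≠ v) (s1 : s ≠ n1) (sx : s ≠ x) : Good G S v u w w' := by
  have hw2 : ¬ G.Adj w n2 := c1.no_edge huw.ne huv.ne hun2.ne hun1.ne nwv nw1 nv2.symm n12.symm hv1
  have hww : ¬ G.Adj w w' := c2.no_edge huw.ne huv.ne huw'.ne hun1.ne nwv nw1 nvw'.symm nw'1 hv1
  have hs2 : ¬ G.Adj s n2 := c1.no_path huw.ne huv.ne hun2.ne hun1.ne nwv nw1 nv2.symm n12.symm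
    su.symm sv s1 hv1 hws
  have sw' : s ≠ w' := by rintro rfl; exact hww hws
  have s2 : s ≠ n2 := by rintro rfl; exact hw2 hws
  have hus : ¬ G.Adj u s := by
    intro h
    rcases hNu s h with h | h | h | h | h
    · exact hws.ne h.symm
    · exact sv h
    · exact sw' h
    · exact s1 h
    · exact s2 h
  obtain ⟨R, r1, r2, r3, r4⟩ := ident3 hG hS hS5 (a := n2) (p := u) (q := w) (b := s)
    (by rw [hmem]; simp [nv2.symm, hun2.ne', nw2.symm, nw'2.symm, n2x])
    (by rw [hmem]; simp [sv, su, hws.ne', sw', sx])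
    (by rw [hmem]; simp) (by rw [hmem]; simp) s2.symm (fun h => hs2 h.symm) hun2.symm huw hws
    (fun h => hw2 h.symm) hus
  exact ⟨n2, R, Or.inl hun2, r1, r3, r4⟩

theorem pair2 [Fintype V] (hG : IsMinimalCounterexample G σ) {S : List V} (hS : S.Nodup)
    (hS5 : S.length = 5) {v u w w' x n1 n2 y s : V}
    (hmem : ∀ y, y ∈ S ↔ y = v ∨ y = u ∨ y = w ∨ y = w' ∨ y = x)
    (hvu : G.Adj v u) (hvw : G.Adj v w) (hvw' : G.Adj v w') (hvx : G.Adj v x)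
    (huw' : G.Adj u w') (hun1 : G.Adj u n1) (hun2 : G.Adj u n2)
    (hw'n : G.Adj w' n2) (hw's : G.Adj w' s) (hw'y : G.Adj w' y) (hvy : G.Adj v y)
    (hN : ∀ z, G.Adj w' z → z = n2 ∨ z = u ∨ z = v ∨ z = y ∨ z = s)
    (c1 : Cr G w' u n2 s y) (c2 : Cr G w' v n2 s y)
    (hv1 : ¬ G.Adj v n1) (hv2 : ¬ G.Adj v n2) (n12 : n1 ≠ n2) (nv1 : n1 ≠ v) (nv2 : n2 ≠ v)
    (uy : u ≠ y) (wy : w ≠ y) (yx : y ≠ x) (sn : s ≠ n2) (su : s ≠ u) (sv : s ≠ v) (sy : s ≠ y) :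
    Good G S v u w w' := by
  have key : ∀ z, ¬ G.Adj v z → z ≠ v → z ∉ S := by
    intro z h1 h2
    rw [hmem]
    rintro (rfl | rfl | rfl | rfl | rfl) <;> contradiction
  have yn : y ≠ n2 := by rintro rfl; exact hv2 hvy
  have y1 : n1 ≠ y := by rintro rfl; exact hv1 hvy
  by_cases h : G.Adj y n2
  · have hsv : ¬ G.Adj v s := c2.no_edge hvw'.ne' hw'n.ne hw's.ne hw'y.ne nv2.symm hvy.ne sn sy h.symm
    have hsu : ¬ G.Adj u s := c1.no_edge huw'.ne' hw'n.ne hw's.ne hw'y.ne hun2.ne uy sn sy h.symm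
    have w1 : w' ≠ n1 := by rintro rfl; exact hv1 hvw'
    have h1s : ¬ G.Adj n1 s := c1.no_path huw'.ne' hw'n.ne hw's.ne hw'y.ne hun2.ne uy sn sy
      w1 n12 y1 h.symm hun1
    have s1 : s ≠ n1 := by rintro rfl; exact hsu hun1
    have hw1 : ¬ G.Adj w' n1 := by
      intro h
      rcases hN n1 h with h | h | h | h | h
      · exact n12 h
      · exact hun1.ne h.symm
      · exact nv1 h
      · exact y1 h
      · exact s1 h.symm
    obtain ⟨R, r1, r2, r3, r4⟩ := ident3 hG hS hS5 (a := s) (p := w') (q := u) (b := n1)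
      (key s hsv sv) (key n1 hv1 nv1)
      (by rw [hmem]; simp) (by rw [hmem]; simp) s1 (fun h => h1s h.symm) hw's.symm huw'.symm hun1
      (fun h => hsu h.symm) hw1
    exact ⟨s, R, Or.inr (Or.inr hw's), r1, r3, r4⟩
  · obtain ⟨R, r1, r2, r3, r4⟩ := ident2 hG hS hS5 (a := y) (p := w') (b := n2)
      (by rw [hmem]; simp [hvy.ne', uy.symm, wy.symm, hw'y.ne', yx]) (key n2 hv2 nv2)
      (by rw [hmem]; simp) yn h hw'y.symm hw'n
    exact ⟨y, R, Or.inr (Or.inr hw'y), r1, r3, r4⟩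

theorem caseII_color [Fintype V] (hG : IsMinimalCounterexample G σ) (v u w w' x : V)
    (hv : deg G v = 7) (hdu : deg G u = 5) (hdw : deg G w = 5) (hdw' : deg G w' = 5)
    (hdx : deg G x = 5) (hvu : G.Adj v u) (hvw : G.Adj v w) (hvw' : G.Adj v w') (hvx : G.Adj v x)
    (huw : G.Adj u w) (huw' : G.Adj u w') (hww1 : w ≠ w')
    (hgood : Good G [v, u, w, w', x] v u w w') : False := by
  classical
  have hT := hG.1
  obtain ⟨a, R, ha, hSt, hR1, hR0⟩ := hgood
  have hRL := hSt.2.1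
  simp only [List.mem_cons, List.not_mem_nil, or_false, forall_eq_or_imp, forall_eq] at hRL
  obtain ⟨rv, ru, rw_, rw', rx⟩ := hRL
  have one : ∀ {L : List V} {R : Set V} {z b : V}, St G (z :: L) R → deg G z = 5 → G.Adj z b →
      (b ∈ L ∨ b ∈ R) → St G L R := by
    intro L R z b h1 h2 h3 h4
    exact St.kempe hT h1 [b] (by simp) (by simpa using ⟨h3, h4⟩) (by simp; omega)
  have fin0 : (∃ t, t ∈ R ∧ (G.Adj u t ∨ G.Adj w t ∨ G.Adj w' t)) → False := by
    rintro ⟨t, ht, hadj⟩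
    have s0 : St G [x, v, u, w, w'] R := hSt.perm
      (List.Perm.map ![v, u, w, w', x] (by decide : ([0, 1, 2, 3, 4] : List (Fin 5)).Perm [4, 0, 1, 2, 3]))
    have s1 := one s0 hdx hvx.symm (by simp)
    have s2 : St G [u, w, w'] R := by
      refine St.kempe hT s1 [u, w, w'] ?_ ?_ (by simp; omega)
      · simp [huw'.ne, huw.ne, hww1]
      · simp [hvu, hvw, hvw']
    rcases hadj with h | h | h
    · have s3 : St G [w, w', u] R := s2.perm
        (List.Perm.map ![u, w, w'] (by decide : ([0, 1, 2] : List (Fin 3)).Perm [1, 2, 0]))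
      have s4 := one s3 hdw huw.symm (by simp)
      have s5 := one s4 hdw' huw'.symm (by simp)
      exact St.final hG (one s5 hdu h (Or.inr ht)) hR0
    · have s3 : St G [w', u, w] R := s2.perm
        (List.Perm.map ![u, w, w'] (by decide : ([0, 1, 2] : List (Fin 3)).Perm [2, 0, 1]))
      have s4 := one s3 hdw' huw'.symm (by simp)
      have s5 := one s4 hdu huw (by simp)
      exact St.final hG (one s5 hdw h (Or.inr ht)) hR0
    · have s3 : St G [w, u, w'] R := s2.perm
        (List.Perm.map ![u, w, w'] (by decide : ([0, 1, 2] : List (Fin 3)).Perm [1, 0, 2]))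
      have s4 := one s3 hdw huw.symm (by simp)
      have s5 := one s4 hdu huw' (by simp)
      exact St.final hG (one s5 hdw' h (Or.inr ht)) hR0
  by_cases haR : a ∈ R
  · exact fin0 ⟨a, haR, ha⟩
  have hRc := hR1 haR
  have fin1 : ∀ z : V, 6 * (insert z R).ncard ≤ Fintype.card V := by
    intro z
    have := ncard_insert_le' R z
    omega
  by_cases hY : ∃ y, G.Adj v y ∧ y ∈ R
  · obtain ⟨y, hvy, hyR⟩ := hY
    have yu : y ≠ u := by rintro rfl; exact ru hyR
    have yw : y ≠ w := by rintro rfl; exact rw_ hyR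
    have s0 : St G [u, x, w', v, w] R := hSt.perm
      (List.Perm.map ![v, u, w, w', x] (by decide : ([0, 1, 2, 3, 4] : List (Fin 5)).Perm [1, 4, 3, 0, 2]))
    have s1 := St.addRed s0 (fun t ht _ htR => fin0 ⟨t, htR, Or.inl ht⟩)
    have s2 := one s1 hdx hvx.symm (by simp)
    have s4 := one s2 hdw' hvw'.symm (by simp)
    have s5 : St G [w] (insert u R) := by
      refine St.kempe hT s4 [u, y, w] ?_ ?_ (by simp; omega)
      · simp [yu.symm, huw.ne, yw]
      · simp [hvy, hvu, hvw, hyR]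
    have s6 := one s5 hdw huw.symm (by simp)
    exact St.final hG s6 (fin1 u)
  · push Not at hY
    have s1 := St.addRed hSt (fun t ht _ => hY t ht)
    have s2 := one s1 hdu hvu.symm (by simp)
    have s3 := one s2 hdw hvw.symm (by simp)
    have s4 := one s3 hdw' hvw'.symm (by simp)
    have s5 := one s4 hdx hvx.symm (by simp)
    exact St.final hG s5 (fin1 v)

theorem Good.symm [Fintype V] {S : List V} {v u w w' : V} (h : Good G S v u w' w) :
    Good G S v u w w' := by
  obtain ⟨a, R, h1, h2⟩ := h
  exact ⟨a, R, by tauto, h2⟩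

theorem caseII [Fintype V] (hG : IsMinimalCounterexample G σ) (v u w w' : V)
    (hv : deg G v = 7)
    (h4 : Nat.card {y : V | G.Adj v y ∧ deg G y = 5} = 4)
    (hnext : NextNbr σ v u w) (hprev : NextNbr σ v w' u)
    (hdw : deg G w = 5) (hdw' : deg G w' = 5) (hdu : deg G u = 5) : False := by
  classical
  have hT := hG.1
  have hr := hT.rot
  have hf := hT.face_size_eq
  have hvu := hnext.1
  have hvw := next_right hr hnext
  have hvw' := hprev.1
  have huw : G.Adj u w := next_adj hr hf hnext
  have huw' : G.Adj u w' := (next_adj hr hf hprev).symm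
  obtain ⟨-, -, hww⟩ := next_ne2 hr (by omega) hprev hnext
  obtain ⟨x, ⟨hvx, hdx⟩, hnd, -⟩ := exists_one h4 (a := u) (b := w) (c := w') ⟨hvu, hdu⟩ ⟨hvw, hdw⟩
    ⟨hvw', hdw'⟩ huw.ne huw'.ne hww.symm
  have hS : [v, u, w, w', x].Nodup := by
    rw [List.nodup_cons]
    refine ⟨?_, hnd⟩
    simp [hvu.ne, hvw.ne, hvw'.ne, hvx.ne]
  simp only [List.nodup_cons, List.mem_cons, List.not_mem_nil, or_false, not_or] at hnd
  obtain ⟨⟨-, -, ux⟩, ⟨-, wx⟩, w'x, -⟩ := hnd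
  refine caseII_color hG v u w w' x hv hdu hdw hdw' hdx hvu hvw hvw' hvx huw huw' hww.symm ?_
  -- local rotations
  have a1 := next_rot hr hf hnext
  have a2 := next_rot hr hf a1
  have b1 := next_rot hr hf hprev
  have b2 := next_rot hr hf b1
  obtain ⟨n2, a3⟩ := exists_next hr (next_right hr b1)
  obtain ⟨n1, a4⟩ := exists_next hr (next_right hr a3)
  obtain ⟨a5, ndu, Nu, cu0, cu1, cu2, -, cu3⟩ := five_around hT hdu a2 b1 a3 a4
  have w1 := next_rot hr hf a5
  obtain ⟨s, w2⟩ := exists_next hr (next_right hr w1)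
  obtain ⟨u3, w3⟩ := exists_next hr (next_right hr w2)
  obtain ⟨w4, ndw, Nw, -, -, -, cw1, cw2⟩ := five_around hT hdw a1 w1 w2 w3
  have p1 := next_rot hr hf (next_rot hr hf a3)
  obtain ⟨y, p2⟩ := exists_next hr (next_right hr b2)
  obtain ⟨s', p3⟩ := exists_next hr (next_right hr p2)
  obtain ⟨p4, ndw', Nw', -, -, cp1, cp2, -⟩ := five_around hT hdw' p1 b2 p2 p3
  have v1 := next_rot hr hf (next_rot hr hf p2)
  have v2 := next_rot hr hf w4
  have hvy := v1.1
  have hvu3 := next_right hr v2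
  have e0 : ((σ ^ 0) ⟨(v, y), hvy⟩).toProd.2 = y := by simp
  have e1 := next_pow hr hvy 0 e0 v1
  have e2 := next_pow hr hvy 1 e1 hprev
  have e3 := next_pow hr hvy 2 e2 hnext
  have e4 := next_pow hr hvy 3 e3 v2
  have hne : ∀ i j : ℕ, ∀ p q : V, i < 5 → j < 5 → i ≠ j → ((σ ^ i) ⟨(v, y), hvy⟩).toProd.2 = p →
      ((σ ^ j) ⟨(v, y), hvy⟩).toProd.2 = q → p ≠ q := by
    intro i j p q hi hj hij hp hq hpq
    exact hij (pow_snd_inj hr hvy (by omega) (by omega) (by rw [hp, hq, hpq]))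
  have yu := hne 0 2 _ _ (by omega) (by omega) (by omega) e0 e2
  have yw := hne 0 3 _ _ (by omega) (by omega) (by omega) e0 e3
  have yu3 := hne 0 4 _ _ (by omega) (by omega) (by omega) e0 e4
  have w'u3 := hne 1 4 _ _ (by omega) (by omega) (by omega) e1 e4
  have uu3 := hne 2 4 _ _ (by omega) (by omega) (by omega) e2 e4
  have hun1 := a5.1
  have hun2 := a4.1
  have hwn1 := w2.1
  have hws := w3.1
  have hwu3 := w4.1
  have hw'n2 := p1.1
  have hw'y := p3.1
  have hw's := p4.1
  simp only [List.nodup_cons, List.mem_cons, List.not_mem_nil, or_false, not_or, not_false_eq_true,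
      List.nodup_nil, and_true] at ndu ndw ndw' Nu Nw Nw'
  obtain ⟨⟨wv, ww', wn2, wn1⟩, ⟨vw', vn2, vn1⟩, ⟨w'n2, w'n1⟩, n21⟩ := ndu
  obtain ⟨⟨-, -, vs, vu3⟩, ⟨un1, us, uu3'⟩, ⟨n1s, n1u3⟩, su3⟩ := ndw
  obtain ⟨⟨n2u, n2v, n2y, n2s⟩, ⟨-, -, us'⟩, ⟨-, vs'⟩, ys'⟩ := ndw'
  have hm1 : ∀ z, z ∈ [v, u, w, w', x] ↔ z = v ∨ z = u ∨ z = w ∨ z = w' ∨ z = x := by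
    intro z; simp
  have hm2 : ∀ z, z ∈ [v, u, w, w', x] ↔ z = v ∨ z = u ∨ z = w' ∨ z = w ∨ z = x := by
    intro z; simp [or_comm, or_left_comm]
  have P1 : G.Adj v n1 → n2 ≠ x → Good G [v, u, w, w', x] v u w w' := by
    intro h hx
    have hN : ∀ z, G.Adj u z → z = w ∨ z = v ∨ z = w' ∨ z = n1 ∨ z = n2 := by
      intro z hz; rcases Nu z hz with h | h | h | h | h <;> simp only [h, true_or, or_true]
    by_cases hs : s = x
    · exact pair1 hG hS rfl hm1 huw huw' hun1 hun2 hvu.symm hwu3 hN cu2 cu1 h wv ww' wn1 wn2 vn2 vw'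
        w'n1 w'n2 (Ne.symm n21) hx uu3.symm (Ne.symm vu3) (Ne.symm n1u3) (by rw [← hs]; exact Ne.symm su3)
    · exact pair1 hG hS rfl hm1 huw huw' hun1 hun2 hvu.symm hws hN cu2 cu1 h wv ww' wn1 wn2 vn2 vw'
        w'n1 w'n2 (Ne.symm n21) hx (Ne.symm us) (Ne.symm vs) (Ne.symm n1s) hs
  have P2 : G.Adj v n2 → n1 ≠ x → Good G [v, u, w, w', x] v u w w' := by
    intro h hx
    apply Good.symm
    have hN : ∀ z, G.Adj u z → z = w' ∨ z = v ∨ z = w ∨ z = n2 ∨ z = n1 := by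
      intro z hz; rcases Nu z hz with h | h | h | h | h <;> simp only [h, true_or, or_true]
    by_cases hs : s' = x
    · exact pair1 hG hS rfl hm2 huw' huw hun2 hun1 hvu.symm hw'y hN cu3.rot.flip cu0.rot.rot.flip h
        (Ne.symm vw') (Ne.symm ww') w'n2 w'n1 vn1 (Ne.symm wv)
        wn2 wn1 n21 hx yu (hvy.ne') (Ne.symm n2y) (by rw [← hs]; exact ys')
    · exact pair1 hG hS rfl hm2 huw' huw hun2 hun1 hvu.symm hw's hN cu3.rot.flip cu0.rot.rot.flip h
        (Ne.symm vw') (Ne.symm ww') w'n2 w'n1 vn1 (Ne.symm wv)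
        wn2 wn1 n21 hx (Ne.symm us') (Ne.symm vs') (Ne.symm n2s) hs
  by_cases h1 : G.Adj v n1
  · by_cases hx : n2 = x
    · exact P2 (hx ▸ hvx) (by rw [← hx]; exact Ne.symm n21)
    · exact P1 h1 hx
  by_cases h2 : G.Adj v n2
  · exact P2 h2 (by rintro rfl; exact h1 hvx)
  by_cases hy : y = x
  · have hu3x : u3 ≠ x := by rw [← hy]; exact yu3.symm
    apply Good.symm
    refine pair2 hG hS rfl hm2 hvu hvw' hvw hvx huw hun2 hun1 hwn1 hws hwu3 hvu3 ?_ cw2 cw1 h2 h1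
      n21 (Ne.symm vn2) (Ne.symm vn1) uu3 w'u3 hu3x (Ne.symm n1s) (Ne.symm us) (Ne.symm vs) su3
    intro z hz; rcases Nw z hz with h | h | h | h | h <;> simp only [h, true_or, or_true]
  · refine pair2 hG hS rfl hm1 hvu hvw hvw' hvx huw' hun1 hun2 hw'n2 hw's hw'y hvy ?_ cp1.rot.flip
      cp2.rot.flip h1 h2 (Ne.symm n21) (Ne.symm vn1) (Ne.symm vn2) yu.symm yw.symm hy (Ne.symm n2s)
      (Ne.symm us') (Ne.symm vs') (Ne.symm ys')
    intro z hz; rcases Nw' z hz with h | h | h | h | h <;> simp only [h, true_or, or_true]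
end RS

theorem statement12 [Fintype V] (G : SimpleGraph V) (σ : Equiv.Perm G.Dart)
    (hG : IsMinimalCounterexample G σ) (v u w w' : V)
    (hv : deg G v = 7)
    (h4 : Nat.card {y : V | G.Adj v y ∧ deg G y = 5} = 4)
    (hu : G.Adj v u)
    (hnext : NextNbr σ v u w) (hprev : NextNbr σ v w' u)
    (hdw : deg G w = 5) (hdw' : deg G w' = 5) :
    9 ≤ deg G u := by
  by_contra hlt
  have h5 := RS.five_le_deg hG u
  by_cases h : deg G u = 5
  · exact RS.caseII hG v u w w' hv h4 hnext hprev hdw hdw' h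
  · exact RS.caseI hG v u w w' hv h4 hnext hprev hdw hdw' (by omega) (by omega)
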